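/- arXiv:1111.6807 — 3 statements merged into one kernel-verified Lean document; each statement's English description precedes it below -/
import Mathlib

section
/- For any convex body A in ℝⁿ, 2 ≤ |A−A|^{1/n}/|A|^{1/n} ≤ (binomial(2n,n))^{1/n} < 4, where A−A = {x−y : x,y ∈ A} is the difference body and |·| denotes n-dimensional volume. -/
open MeasureTheory Real Pointwise

/-- One-dimensional Brunn–Minkowski for compact sets. -/
lemma bm_one_compact {A B : Set ℝ} (hA : IsCompact A) (hB : IsCompact B) (hA' : A.Nonempty)
    (hB' : B.Nonempty) : volume A + volume B ≤ volume (A + B) := by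
  obtain ⟨a, ha, hamax⟩ := hA.exists_isGreatest hA'
  obtain ⟨b, hb, hbmin⟩ := hB.exists_isLeast hB'
  have h1 : (b +ᵥ A) ∪ (a +ᵥ B) ⊆ A + B := by
    rintro x (⟨y, hy, rfl⟩ | ⟨y, hy, rfl⟩)
    · exact ⟨y, hy, b, hb, by simp [add_comm]⟩
    · exact ⟨a, ha, y, hy, by simp⟩
  have h2 : (b +ᵥ A) ∩ (a +ᵥ B) ⊆ {a + b} := by
    rintro x ⟨⟨y, hy, rfl⟩, ⟨z, hz, hzy⟩⟩
    have := hamax hy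
    have := hbmin hz
    simp only [vadd_eq_add] at hzy ⊢
    simp only [Set.mem_singleton_iff]
    linarith
  have h3 : volume ((b +ᵥ A) ∩ (a +ᵥ B)) = 0 :=
    measure_mono_null h2 (by simp)
  have hBm : MeasurableSet (a +ᵥ B) := (hB.vadd a).measurableSet
  have := measure_union_add_inter (μ := (volume : Measure ℝ)) (b +ᵥ A) hBm
  rw [h3, add_zero, measure_vadd, measure_vadd] at this
  rw [← this]
  exact measure_mono h1

/-- One-dimensional Brunn–Minkowski for measurable sets. -/
lemma bm_one {A B : Set ℝ} (hA : MeasurableSet A) (hB : MeasurableSet B) (hA' : A.Nonempty)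
    (hB' : B.Nonempty) : volume A + volume B ≤ volume (A + B) := by
  obtain ⟨a, ha⟩ := hA'
  obtain ⟨b, hb⟩ := hB'
  rw [hA.measure_eq_iSup_isCompact, hB.measure_eq_iSup_isCompact]
  simp only [iSup_and']
  refine ENNReal.biSup_add_biSup_le' ⟨∅, Set.empty_subset _, isCompact_empty⟩
    ⟨∅, Set.empty_subset _, isCompact_empty⟩ ?_
  rintro K ⟨hK, hKc⟩ L ⟨hL, hLc⟩
  calc volume K + volume L ≤ volume (insert a K) + volume (insert b L) := by
        gcongr <;> exact Set.subset_insert _ _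
    _ ≤ volume (insert a K + insert b L) :=
        bm_one_compact (hKc.insert a) (hLc.insert b) ⟨a, by simp⟩ ⟨b, by simp⟩
    _ ≤ _ := measure_mono (Set.add_subset_add (Set.insert_subset ha hK) (Set.insert_subset hb hL))

lemma layer (f : ℝ → ENNReal) (hf : Measurable f) (h1 : ∀ x, f x ≤ 1) :
    ∫⁻ x, f x = ∫⁻ t in Set.Ioi (0:ℝ), volume {x | ENNReal.ofReal t < f x} := by
  have := lintegral_eq_lintegral_meas_lt (volume : Measure ℝ) (f := fun x => (f x).toReal)
    (Filter.Eventually.of_forall fun x => ENNReal.toReal_nonneg) hf.ennreal_toReal.aemeasurable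
  have hne : ∀ x, f x ≠ ⊤ := fun x => ne_top_of_le_ne_top ENNReal.one_ne_top (h1 x)
  simp only [ENNReal.ofReal_toReal (hne _)] at this
  rw [this]
  refine setLIntegral_congr_fun measurableSet_Ioi fun t ht => ?_
  congr 1
  ext x
  simp only [Set.mem_ofPred_eq]
  rw [ENNReal.ofReal_lt_iff_lt_toReal (le_of_lt ht) (hne x)]

lemma pl_norm (f g h : ℝ → ENNReal) (hf : Measurable f) (hg : Measurable g) (hh : Measurable h)
    (sf : ⨆ x, f x = 1) (sg : ⨆ x, g x = 1)
    (H : ∀ x y, f x * g y ≤ h ((1/2:ℝ) • (x + y)) ^ 2) :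
    (∫⁻ x, f x) + ∫⁻ x, g x ≤ 2 * ∫⁻ x, h x := by
  have f1 : ∀ x, f x ≤ 1 := fun x => sf ▸ le_iSup f x
  have g1 : ∀ x, g x ≤ 1 := fun x => sg ▸ le_iSup g x
  suffices hs : (∫⁻ x, f x) + ∫⁻ x, g x ≤ 2 * ∫⁻ x, min (h x) 1 from
    hs.trans (mul_le_mul_right (lintegral_mono fun x => min_le_left _ _) _)
  rw [layer f hf f1, layer g hg g1, layer _ (hh.min measurable_const) (fun x => min_le_right _ _)]
  have mf : Measurable fun t : ℝ => volume {x | ENNReal.ofReal t < f x} := by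
    apply Antitone.measurable
    intro s t hst
    exact measure_mono fun x hx => lt_of_le_of_lt (ENNReal.ofReal_le_ofReal hst) hx
  rw [← lintegral_add_left mf, ← lintegral_const_mul' _ _ (by simp)]
  refine setLIntegral_mono' measurableSet_Ioi fun t ht => ?_
  rcases le_or_gt 1 t with h1t | h1t
  · have ht1 : (1:ENNReal) ≤ ENNReal.ofReal t := by simpa using h1t
    have e1 : {x | ENNReal.ofReal t < f x} = ∅ := by
      ext x; simpa using (f1 x).trans ht1
    have e2 : {x | ENNReal.ofReal t < g x} = ∅ := by
      ext x; simpa using (g1 x).trans ht1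
    simp [e1, e2]
  · have ht1 : ENNReal.ofReal t < 1 := by simpa using h1t
    have ne1 : {x | ENNReal.ofReal t < f x}.Nonempty := by
      obtain ⟨i, hi⟩ := lt_iSup_iff.1 (lt_of_lt_of_eq ht1 sf.symm)
      exact ⟨i, hi⟩
    have ne2 : {x | ENNReal.ofReal t < g x}.Nonempty := by
      obtain ⟨i, hi⟩ := lt_iSup_iff.1 (lt_of_lt_of_eq ht1 sg.symm)
      exact ⟨i, hi⟩
    refine (bm_one (measurableSet_lt measurable_const hf) (measurableSet_lt measurable_const hg)
      ne1 ne2).trans ?_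
    have hsub : (1/2:ℝ) • ({x | ENNReal.ofReal t < f x} + {x | ENNReal.ofReal t < g x}) ⊆
        {x | ENNReal.ofReal t < min (h x) 1} := by
      rintro _ ⟨_, ⟨x, hx, y, hy, rfl⟩, rfl⟩
      simp only [Set.mem_ofPred_eq] at hx hy ⊢
      refine lt_min ?_ ht1
      have : ENNReal.ofReal t ^ 2 < h ((1/2:ℝ) • (x + y)) ^ 2 := by
        refine lt_of_lt_of_le ?_ (H x y)
        rw [sq]
        exact ENNReal.mul_lt_mul hx hy
      exact lt_of_not_ge fun hle => absurd this (not_lt.2 (pow_le_pow_left₀ zero_le hle 2))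
    have := measure_mono (μ := volume) hsub
    rw [Measure.addHaar_smul] at this
    calc _ = 2 * (ENNReal.ofReal |(1/2:ℝ) ^ Module.finrank ℝ ℝ| * volume
          ({x | ENNReal.ofReal t < f x} + {x | ENNReal.ofReal t < g x})) := by
          rw [← mul_assoc]
          have : 2 * ENNReal.ofReal |(1/2:ℝ) ^ Module.finrank ℝ ℝ| = 1 := by
            simp only [Module.finrank_self, pow_one]
            rw [abs_of_pos (by norm_num), ← ENNReal.ofReal_ofNat 2,
              ← ENNReal.ofReal_mul (by norm_num)]
            norm_num
          rw [this, one_mul]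
      _ ≤ _ := by gcongr

lemma am_gm_enn (a b : ENNReal) : 4 * (a * b) ≤ (a + b) ^ 2 := by
  rcases eq_or_ne a ⊤ with rfl | ha
  · simp
  rcases eq_or_ne b ⊤ with rfl | hb
  · simp
  lift a to NNReal using ha
  lift b to NNReal using hb
  norm_cast
  rw [← NNReal.coe_le_coe]
  push_cast
  nlinarith [sq_nonneg ((a:ℝ) - b)]

lemma pl_bdd (f g h : ℝ → ENNReal) (hf : Measurable f) (hg : Measurable g) (hh : Measurable h)
    (sf : ⨆ x, f x ≠ ⊤) (sg : ⨆ x, g x ≠ ⊤)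
    (H : ∀ x y, f x * g y ≤ h ((1/2:ℝ) • (x + y)) ^ 2) :
    (∫⁻ x, f x) * ∫⁻ x, g x ≤ (∫⁻ x, h x) ^ 2 := by
  set S := ⨆ x, f x with hS
  set T := ⨆ x, g x with hT
  rcases eq_or_ne S 0 with h0 | hS0
  · have : ∀ x, f x = 0 := fun x => le_antisymm (h0 ▸ le_iSup f x) zero_le
    simp [this]
  rcases eq_or_ne T 0 with h0 | hT0
  · have : ∀ x, g x = 0 := fun x => le_antisymm (h0 ▸ le_iSup g x) zero_le
    simp [this]
  obtain ⟨c, hc⟩ : ∃ c : ENNReal, c ^ 2 = S * T := by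
    refine ⟨(S * T) ^ (1/2:ℝ), ?_⟩
    rw [← ENNReal.rpow_natCast, ← ENNReal.rpow_mul]
    norm_num
  have hST0 : S * T ≠ 0 := mul_ne_zero hS0 hT0
  have hSTt : S * T ≠ ⊤ := ENNReal.mul_ne_top sf sg
  have hc0 : c ≠ 0 := by rintro rfl; simp at hc; tauto
  have hct : c ≠ ⊤ := by rintro rfl; simp at hc; exact hSTt hc.symm
  have hci : (c⁻¹) ^ 2 = S⁻¹ * T⁻¹ := by
    rw [← ENNReal.inv_pow, hc, ENNReal.mul_inv (Or.inl hS0) (Or.inl sf)]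
  have key := pl_norm (fun x => S⁻¹ * f x) (fun x => T⁻¹ * g x) (fun x => c⁻¹ * h x)
    (hf.const_mul _) (hg.const_mul _) (hh.const_mul _)
    (by rw [← ENNReal.mul_iSup, ENNReal.inv_mul_cancel hS0 sf])
    (by rw [← ENNReal.mul_iSup, ENNReal.inv_mul_cancel hT0 sg])
    (fun x y => by
      rw [mul_pow, hci, mul_mul_mul_comm]
      gcongr
      exact H x y)
  rw [lintegral_const_mul _ hf, lintegral_const_mul _ hg, lintegral_const_mul _ hh] at key
  have k2 := (am_gm_enn _ _).trans (pow_le_pow_left₀ zero_le key 2)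
  rw [mul_pow, mul_pow, hci, mul_mul_mul_comm] at k2
  have k3 : (2:ENNReal) ^ 2 = 4 := by norm_num
  rw [k3, ENNReal.mul_le_mul_iff_right (by norm_num) (by norm_num),
    ← ENNReal.mul_inv (Or.inl hS0) (Or.inl sf),
    ENNReal.mul_le_mul_iff_right (by simpa using hSTt) (by simpa using ⟨hS0, hT0⟩)] at k2
  exact k2

lemma lintegral_trunc (f : ℝ → ENNReal) (hf : Measurable f) :
    ∫⁻ x, f x = ⨆ k : ℕ, ∫⁻ x, min (f x) k := by
  rw [← lintegral_iSup (fun k => hf.min measurable_const)]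
  · congr 1; ext x
    rw [← inf_iSup_eq, ENNReal.iSup_natCast]; simp
  · intro i j hij x
    exact min_le_min le_rfl (by exact_mod_cast hij)

lemma pl_one (f g h : ℝ → ENNReal) (hf : Measurable f) (hg : Measurable g) (hh : Measurable h)
    (H : ∀ x y, f x * g y ≤ h ((1/2:ℝ) • (x + y)) ^ 2) :
    (∫⁻ x, f x) * ∫⁻ x, g x ≤ (∫⁻ x, h x) ^ 2 := by
  rw [lintegral_trunc f hf, lintegral_trunc g hg, ENNReal.iSup_mul]
  refine iSup_le fun i => ?_
  rw [ENNReal.mul_iSup]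
  refine iSup_le fun j => ?_
  refine pl_bdd _ _ h (hf.min measurable_const) (hg.min measurable_const) hh ?_ ?_ ?_
  · exact ne_top_of_le_ne_top (ENNReal.natCast_ne_top i) (iSup_le fun x => min_le_right _ _)
  · exact ne_top_of_le_ne_top (ENNReal.natCast_ne_top j) (iSup_le fun x => min_le_right _ _)
  · intro x y
    refine le_trans ?_ (H x y)
    gcongr <;> exact min_le_left _ _

lemma lint_succ (n : ℕ) (f : (Fin (n+1) → ℝ) → ENNReal) (hf : Measurable f) :
    ∫⁻ x, f x = ∫⁻ t : ℝ, ∫⁻ y : Fin n → ℝ, f (Fin.cons t y) := by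
  have e := (volume_preserving_piFinSuccAbove (fun _ : Fin (n + 1) => ℝ) 0).symm
  rw [← e.lintegral_comp hf]
  rw [Measure.volume_eq_prod]
  have hc : ∀ t : ℝ, ∀ y : Fin n → ℝ, (MeasurableEquiv.piFinSuccAbove (fun _ : Fin (n+1) => ℝ) 0).symm (t, y)
      = Fin.cons t y := by
    intro t y
    simp [MeasurableEquiv.piFinSuccAbove, Fin.insertNthEquiv]
  simp only [← hc]
  exact lintegral_prod (μ := (volume : Measure ℝ)) (ν := (volume : Measure (Fin n → ℝ))) _ (hf.comp e.measurable).aemeasurable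

lemma pl (n : ℕ) : ∀ (f g h : (Fin n → ℝ) → ENNReal) (_ : Measurable f) (_ : Measurable g)
    (_ : Measurable h) (_ : ∀ x y, f x * g y ≤ h ((1/2:ℝ) • (x + y)) ^ 2),
    (∫⁻ x, f x) * ∫⁻ x, g x ≤ (∫⁻ x, h x) ^ 2 := by
  induction n with
  | zero =>
    intro f g h hf hg hh H
    simp only [lintegral_unique]
    have := H (@default _ Unique.instInhabited) (@default _ Unique.instInhabited)
    rw [Subsingleton.elim ((1/2:ℝ) • ((@default _ Unique.instInhabited) + (@default _ Unique.instInhabited) : Fin 0 → ℝ))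
      (@default _ Unique.instInhabited)] at this
    have e : (volume : Measure (Fin 0 → ℝ)) Set.univ = 1 := by
      simp [volume_pi]
    rw [e]
    simp only [mul_one]
    exact this
  | succ n ih =>
    intro f g h hf hg hh H
    rw [lint_succ n f hf, lint_succ n g hg, lint_succ n h hh]
    have mc : Measurable fun p : ℝ × (Fin n → ℝ) => (Fin.cons p.1 p.2 : Fin (n+1) → ℝ) := by
      rw [measurable_pi_iff]
      intro i
      refine Fin.cases ?_ (fun j => ?_) i
      · simpa using measurable_fst
      · simp only [Fin.cons_succ]; fun_prop
    refine pl_one _ _ _ (hf.comp mc).lintegral_prod_right' (hg.comp mc).lintegral_prod_right'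
      (hh.comp mc).lintegral_prod_right' ?_
    intro s t
    have mc' : ∀ s : ℝ, Measurable fun y : Fin n → ℝ => (Fin.cons s y : Fin (n+1) → ℝ) :=
      fun s => mc.comp measurable_prodMk_left
    refine ih _ _ _ (hf.comp (mc' s)) (hg.comp (mc' t)) (hh.comp (mc' _)) ?_
    intro x y
    refine (H _ _).trans (le_of_eq ?_)
    congr 2
    ext i
    refine Fin.cases ?_ (fun j => ?_) i <;> simp [mul_add]

lemma compact_diff {n : ℕ} {A : Set (Fin n → ℝ)} (hA : IsCompact A) : IsCompact (A - A) := by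
  rw [sub_eq_add_neg]
  exact hA.add hA.neg

lemma beta_nat (a b : ℕ) : (∫ x in (0:ℝ)..1, x ^ a * (1 - x) ^ b) * (a + b + 1).factorial
    = a.factorial * b.factorial := by
  induction b generalizing a with
  | zero =>
    simp [integral_pow, Nat.factorial_succ]
    field_simp
  | succ b ih =>
    have h1 : ∀ x ∈ Set.uIcc (0:ℝ) 1, HasDerivAt (fun x : ℝ => x ^ (a+1) * (1 - x) ^ (b+1))
        ((a+1) * (x ^ a * (1 - x) ^ (b+1)) - (b+1) * (x ^ (a+1) * (1 - x) ^ b)) x := by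
      intro x _
      have := (hasDerivAt_pow (a+1) x).mul (((hasDerivAt_id x).const_sub 1).pow (b+1))
      convert! this using 1
      simp
      ring
    have h2 := intervalIntegral.integral_eq_sub_of_hasDerivAt h1
      (Continuous.intervalIntegrable (by fun_prop) _ _)
    rw [intervalIntegral.integral_sub (Continuous.intervalIntegrable (by fun_prop) _ _)
      (Continuous.intervalIntegrable (by fun_prop) _ _), intervalIntegral.integral_const_mul,
      intervalIntegral.integral_const_mul] at h2
    simp at h2
    have h3 := ih (a+1)
    rw [show a + 1 + b + 1 = a + (b + 1) + 1 by ring] at h3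
    rw [Nat.factorial_succ b]
    rw [Nat.factorial_succ a] at h3
    push_cast at h3 ⊢
    have ha : ((a:ℝ) + 1) ≠ 0 := by positivity
    apply mul_left_cancel₀ ha
    linear_combination ((a + (b + 1) + 1).factorial : ℝ) * h2 + (b+1) * h3

lemma beta_choose (n : ℕ) (hn : 0 < n) :
    ∫ t in (0:ℝ)..1, (1 - t) ^ n * (n * t ^ (n - 1)) = ((Nat.choose (2 * n) n : ℝ))⁻¹ := by
  obtain ⟨m, rfl⟩ : ∃ m, n = m + 1 := ⟨n - 1, by omega⟩
  have := beta_nat m (m+1)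
  have e : ∫ t in (0:ℝ)..1, (1 - t) ^ (m+1) * (((m+1:ℕ):ℝ) * t ^ (m + 1 - 1)) =
    (m+1) * ∫ t in (0:ℝ)..1, t ^ m * (1 - t) ^ (m+1) := by
    rw [← intervalIntegral.integral_const_mul]
    congr 1; ext t; simp; ring
  rw [e]
  have h2 := Nat.choose_mul_factorial_mul_factorial (show m + 1 ≤ 2 * (m+1) by omega)
  rw [show 2 * (m+1) - (m+1) = m + 1 by omega] at h2
  rw [show m + (m+1) + 1 = 2 * (m+1) by ring] at this
  rw [← h2] at this
  apply eq_inv_of_mul_eq_one_left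
  push_cast [Nat.factorial_succ m] at this ⊢
  have f0 : (m.factorial : ℝ) ≠ 0 := by positivity
  have m0 : ((m:ℝ)+1) ≠ 0 := by positivity
  apply mul_left_cancel₀ (mul_ne_zero f0 (mul_ne_zero m0 f0))
  linear_combination this

lemma cov_integral (n : ℕ) (A : Set (Fin n → ℝ)) (hA : MeasurableSet A) :
    ∫⁻ x : Fin n → ℝ, volume (A ∩ (x +ᵥ A)) = volume A * volume A := by
  have h : ∀ x : Fin n → ℝ, volume (A ∩ (x +ᵥ A)) =
      ∫⁻ z, A.indicator 1 z * A.indicator 1 (z - x) := by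
    intro x
    rw [← lintegral_indicator_one (hA.inter (hA.const_vadd x))]
    congr 1; ext z
    rw [Set.inter_indicator_one]
    simp only [Pi.mul_apply]
    congr 1
    have hmem : z ∈ x +ᵥ A ↔ z - x ∈ A := by
      rw [Set.mem_vadd_set_iff_neg_vadd_mem, vadd_eq_add, neg_add_eq_sub]
    by_cases hz : z - x ∈ A
    · rw [Set.indicator_of_mem hz, Set.indicator_of_mem (hmem.2 hz)]; rfl
    · rw [Set.indicator_of_notMem hz, Set.indicator_of_notMem (fun h => hz (hmem.1 h))]
  have mi : Measurable (A.indicator (1 : (Fin n → ℝ) → ENNReal)) := measurable_one.indicator hA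
  simp_rw [h]
  rw [lintegral_lintegral_swap]
  · have : ∀ z : Fin n → ℝ, ∫⁻ x, A.indicator (1 : (Fin n → ℝ) → ENNReal) z *
        A.indicator (1 : (Fin n → ℝ) → ENNReal) (z - x)
        = A.indicator 1 z * volume A := by
      intro z
      rw [lintegral_const_mul _ (by fun_prop),
        lintegral_sub_left_eq_self (fun x => A.indicator (1 : (Fin n → ℝ) → ENNReal) x) z,
        lintegral_indicator_one hA]
    simp_rw [this]
    rw [lintegral_mul_const _ mi, lintegral_indicator_one hA]
  · apply Measurable.aemeasurable
    exact (mi.comp measurable_snd).mul (mi.comp (measurable_snd.sub measurable_fst))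

lemma cov_lower (n : ℕ) (A : Set (Fin n → ℝ)) (hconv : Convex ℝ A) (r : ℝ) (hr0 : 0 ≤ r)
    (hr1 : r ≤ 1) (x : Fin n → ℝ) (hx : x ∈ r • (A - A)) :
    ENNReal.ofReal ((1 - r) ^ n) * volume A ≤ volume (A ∩ (x +ᵥ A)) := by
  obtain ⟨_, ⟨a, ha, b, hb, rfl⟩, rfl⟩ := hx
  have : (r • a) +ᵥ ((1 - r) • A) ⊆ A ∩ ((r • (a - b)) +ᵥ A) := by
    rintro _ ⟨_, ⟨c, hc, rfl⟩, rfl⟩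
    refine ⟨hconv ha hc hr0 (by linarith) (by ring), ?_⟩
    refine ⟨r • b + (1 - r) • c, hconv hb hc hr0 (by linarith) (by ring), ?_⟩
    simp only [vadd_eq_add, smul_sub]
    abel
  refine le_trans (le_of_eq ?_) (measure_mono this)
  rw [measure_vadd, Measure.addHaar_smul_of_nonneg _ (by linarith)]
  simp

lemma rs (n : ℕ) (hn : 0 < n) (A : Set (Fin n → ℝ))
    (hA : IsCompact A) (hconv : Convex ℝ A) (hint : (interior A).Nonempty) :
    volume (A - A) * ENNReal.ofReal ((Nat.choose (2 * n) n : ℝ))⁻¹ ≤ volume A := by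
  have hD0 : A - A ∈ nhds (0 : Fin n → ℝ) := by
    obtain ⟨a, ha⟩ := hint
    have : interior A - A ⊆ A - A := Set.sub_subset_sub_right interior_subset
    refine Filter.mem_of_superset ?_ this
    exact (isOpen_interior.sub_right).mem_nhds ⟨a, ha, a, interior_subset ha, by simp⟩
  have hDc : Convex ℝ (A - A) := hconv.sub hconv
  have hcg := continuous_gauge hDc hD0
  have habs : Absorbent ℝ (A - A) := absorbent_nhds_zero hD0
  set φ : (Fin n → ℝ) → ℝ := fun x => max 0 (1 - gauge (A - A) x) with hφ
  have hφc : Continuous φ := by fun_prop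
  have hpt : ∀ x, ENNReal.ofReal (φ x ^ n) * volume A ≤ volume (A ∩ (x +ᵥ A)) := by
    intro x
    rcases le_or_gt 1 (gauge (A - A) x) with h1 | h1
    · have : φ x = 0 := max_eq_left (by linarith)
      simp [this, hn.ne']
    · have e : φ x = 1 - gauge (A - A) x := max_eq_right (by linarith)
      rw [e]
      have hcont : Filter.Tendsto (fun r : ℝ => ENNReal.ofReal ((1 - r) ^ n) * volume A)
          (nhdsWithin (gauge (A - A) x) (Set.Ioi (gauge (A - A) x)))
          (nhds (ENNReal.ofReal ((1 - gauge (A - A) x) ^ n) * volume A)) := by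
        refine ENNReal.Tendsto.mul_const ?_ (Or.inr hA.measure_lt_top.ne)
        refine ENNReal.tendsto_ofReal ?_
        exact ((by fun_prop : Continuous fun r : ℝ => (1 - r) ^ n).tendsto _).mono_left
          nhdsWithin_le_nhds
      refine le_of_tendsto hcont ?_
      filter_upwards [Ioo_mem_nhdsGT h1] with r hr
      obtain ⟨b, hb0, hbr, hxb⟩ := exists_lt_of_gauge_lt habs hr.1
      refine le_trans ?_ (cov_lower n A hconv b hb0.le (by linarith [hr.2]) x hxb)
      gcongr
      linarith [hr.2]
  have hlay := lintegral_comp_eq_lintegral_meas_le_mul (volume : Measure (Fin n → ℝ))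
    (f := φ) (g := fun t => n * t ^ (n - 1))
    (Filter.Eventually.of_forall fun x => le_max_left _ _) hφc.measurable.aemeasurable
    (fun t _ => Continuous.intervalIntegrable (by fun_prop) _ _)
    ((ae_restrict_iff' measurableSet_Ioi).2 (Filter.Eventually.of_forall fun t ht => by
      have : (0:ℝ) < t := ht
      positivity))
  have hpow : ∀ y : ℝ, ∫ t in (0:ℝ)..y, (n * t ^ (n - 1) : ℝ) = y ^ n := by
    intro y
    obtain ⟨m, rfl⟩ : ∃ m, n = m + 1 := ⟨n - 1, by omega⟩
    rw [intervalIntegral.integral_const_mul, integral_pow]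
    simp
    field_simp
  simp only [hpow] at hlay
  have hlow : volume (A - A) * ENNReal.ofReal ((Nat.choose (2 * n) n : ℝ))⁻¹ ≤
      ∫⁻ x, ENNReal.ofReal (φ x ^ n) := by
    rw [hlay, ← beta_choose n hn, intervalIntegral.integral_of_le zero_le_one,
      ofReal_integral_eq_lintegral_ofReal, ← lintegral_const_mul']
    · refine le_trans ?_ (lintegral_mono_set (Set.Ioc_subset_Ioi_self : Set.Ioc (0:ℝ) 1 ⊆ _))
      refine setLIntegral_mono' measurableSet_Ioc fun t ht => ?_
      have h1t : 0 ≤ 1 - t := by linarith [ht.2]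
      rw [ENNReal.ofReal_mul (by positivity), ← mul_assoc]
      gcongr
      have : (1 - t) • (A - A) ⊆ {a | t ≤ φ a} := by
        intro x hx
        have := gauge_le_of_mem h1t hx
        have h3 : t ≤ 1 - gauge (A - A) x := by linarith
        exact h3.trans (le_max_right _ _)
      refine le_trans (le_of_eq ?_) (measure_mono this)
      rw [Measure.addHaar_smul_of_nonneg _ h1t, mul_comm]
      simp
    · exact (compact_diff hA).measure_lt_top.ne
    · exact (Continuous.integrableOn_Icc (by fun_prop)).mono_set Set.Ioc_subset_Icc_self
    · refine (ae_restrict_iff' measurableSet_Ioc).2 (Filter.Eventually.of_forall fun t ht => ?_)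
      have h1t : 0 ≤ 1 - t := by linarith [ht.2]
      have := ht.1
      simp only [Pi.zero_apply]
      positivity
  have hfin := lintegral_mono hpt (μ := volume)
  rw [cov_integral n A hA.measurableSet, lintegral_mul_const _ (by fun_prop)] at hfin
  have hA0 : volume A ≠ 0 := (Measure.measure_pos_of_nonempty_interior _ hint).ne'
  rw [ENNReal.mul_le_mul_iff_left hA0 hA.measure_lt_top.ne] at hfin
  exact hlow.trans hfin

lemma bm_diff (n : ℕ) (A : Set (Fin n → ℝ)) (hA : IsCompact A) :
    ENNReal.ofReal (2 ^ n) * volume A ≤ volume (A - A) := by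
  have hD : IsCompact ((1/2:ℝ) • (A - A)) := (compact_diff hA).smul _
  have hm := hA.measurableSet
  have key := pl n (A.indicator 1) ((-A).indicator 1) (((1/2:ℝ) • (A - A)).indicator 1)
    (measurable_one.indicator hm) (measurable_one.indicator hm.neg)
    (measurable_one.indicator hD.measurableSet) (by
      intro x y
      by_cases hx : x ∈ A
      · by_cases hy : y ∈ -A
        · have : (1/2:ℝ) • (x + y) ∈ (1/2:ℝ) • (A - A) :=
            Set.smul_mem_smul_set ⟨x, hx, -y, hy, by simp⟩
          rw [Set.indicator_of_mem hx, Set.indicator_of_mem hy, Set.indicator_of_mem this]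
          simp
        · simp [Set.indicator_of_notMem hy]
      · simp [Set.indicator_of_notMem hx])
  rw [lintegral_indicator_one hm, lintegral_indicator_one hm.neg,
    lintegral_indicator_one hD.measurableSet, Measure.measure_neg, ← sq] at key
  have k2 := (ENNReal.pow_le_pow_left_iff (by norm_num)).1 key
  rw [Measure.addHaar_smul_of_nonneg _ (by norm_num)] at k2
  calc _ ≤ ENNReal.ofReal (2 ^ n) * (ENNReal.ofReal ((1/2:ℝ) ^ Module.finrank ℝ (Fin n → ℝ)) *
        volume (A - A)) := by gcongr
    _ = _ := by
      rw [← mul_assoc, ← ENNReal.ofReal_mul (by positivity), Module.finrank_fin_fun, ← mul_pow]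
      norm_num

/-- Rogers–Shephard and Brunn–Minkowski bounds for the difference body:
for a convex body `A ⊂ ℝⁿ`,
`2 ≤ |A−A|^{1/n} / |A|^{1/n} ≤ (binom(2n,n))^{1/n} < 4`. -/
theorem stmt_16 (n : ℕ) (hn : 0 < n) (A : Set (Fin n → ℝ))
    (hA : IsCompact A) (hconv : Convex ℝ A) (hint : (interior A).Nonempty) :
    2 ≤ (volume (A - A)).toReal ^ ((1 : ℝ) / n) / (volume A).toReal ^ ((1 : ℝ) / n) ∧
    (volume (A - A)).toReal ^ ((1 : ℝ) / n) / (volume A).toReal ^ ((1 : ℝ) / n) ≤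
      ((Nat.choose (2 * n) n : ℝ)) ^ ((1 : ℝ) / n) ∧
    ((Nat.choose (2 * n) n : ℝ)) ^ ((1 : ℝ) / n) < 4 := by
  have hA0 : volume A ≠ 0 := (Measure.measure_pos_of_nonempty_interior _ hint).ne'
  have hAt : volume A ≠ ⊤ := hA.measure_lt_top.ne
  have hDt : volume (A - A) ≠ ⊤ := (compact_diff hA).measure_lt_top.ne
  have hpos : 0 < (volume A).toReal := ENNReal.toReal_pos hA0 hAt
  have hC : (0:ℝ) < (Nat.choose (2 * n) n : ℝ) := by
    exact_mod_cast Nat.choose_pos (by omega)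
  have h1 : 2 ^ n * (volume A).toReal ≤ (volume (A - A)).toReal := by
    have := ENNReal.toReal_mono hDt (bm_diff n A hA)
    rwa [ENNReal.toReal_mul, ENNReal.toReal_ofReal (by positivity)] at this
  have h2 : (volume (A - A)).toReal ≤ (Nat.choose (2 * n) n : ℝ) * (volume A).toReal := by
    have := ENNReal.toReal_mono hAt (rs n hn A hA hconv hint)
    rw [ENNReal.toReal_mul, ENNReal.toReal_ofReal (by positivity), ← div_eq_mul_inv,
      div_le_iff₀ hC] at this
    linarith
  have hroot : ∀ x : ℝ, 0 ≤ x → (x ^ n) ^ ((1:ℝ) / n) = x := fun x hx => by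
    rw [one_div]; exact Real.pow_rpow_inv_natCast hx hn.ne'
  have hn' : (0:ℝ) < 1 / n := by positivity
  rw [← Real.div_rpow ENNReal.toReal_nonneg ENNReal.toReal_nonneg]
  refine ⟨?_, ?_, ?_⟩
  · rw [← hroot 2 (by norm_num)]
    exact Real.rpow_le_rpow (by positivity) ((le_div_iff₀ hpos).2 h1) hn'.le
  · exact Real.rpow_le_rpow (by positivity) ((div_le_iff₀ hpos).2 h2) hn'.le
  · rw [← hroot 4 (by norm_num)]
    refine Real.rpow_lt_rpow hC.le ?_ hn'
    have := Nat.centralBinom_lt_four_pow hn.ne'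
    rw [Nat.centralBinom_eq_two_mul_choose] at this
    exact_mod_cast this
end

section
/- Fix β₀ > 1. Let X be a random vector in ℝⁿ with density f = V^{−β} where V is a positive convex function on the support of f, and β ≥ n+1, β ≥ β₀ n. Then h(X) ≤ (β₀/(β₀−1))·n + log(1/‖f‖_∞). -/
open MeasureTheory Real

noncomputable def gam (β w : ℝ) : ℝ := if w ≤ 1 then 1 else w ^ (1 - β) * (Real.log w / (w - 1))

lemma rpow_tangent {a z : ℝ} (ha : 0 ≤ a) (hz : 0 < z) : 1 + a * (1 - z) ≤ z ^ (-a) := by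
  rw [Real.rpow_def_of_pos hz]
  have h1 := Real.add_one_le_exp (Real.log z * -a)
  have h2 := Real.log_le_sub_one_of_pos hz
  nlinarith

lemma rpow_chord {β s u : ℝ} (hβ : 0 ≤ β) (hs : s < 1) (hs0 : 0 ≤ s) (hu : 0 ≤ u) (hu1 : u ≤ 1) :
    (1 - s * u) ^ (-β) ≤ 1 + u * ((1 - s) ^ (-β) - 1) := by
  have hz : 0 < 1 - s * u := by nlinarith
  have h1s : 0 < 1 - s := by linarith
  rw [Real.rpow_def_of_pos hz, Real.rpow_def_of_pos h1s]
  have hlog : u * Real.log (1 - s) ≤ Real.log (1 - s * u) := by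
    have := strictConcaveOn_log_Ioi.concaveOn.2 (Set.mem_Ioi.2 one_pos) (Set.mem_Ioi.2 h1s)
      (sub_nonneg.2 hu1) hu (by ring)
    simp only [smul_eq_mul, Real.log_one, mul_zero, zero_add] at this
    have e : (1 - u) * 1 + u * (1 - s) = 1 - s * u := by ring
    rwa [e] at this
  have hexp := convexOn_exp.2 (Set.mem_univ 0) (Set.mem_univ (Real.log (1 - s) * -β))
      (sub_nonneg.2 hu1) hu (by ring)
  simp only [smul_eq_mul, mul_zero, zero_add, Real.exp_zero] at hexp
  have : Real.exp (Real.log (1 - s * u) * -β) ≤ Real.exp (u * (Real.log (1 - s) * -β)) := by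
    apply Real.exp_le_exp.2; nlinarith
  linarith

lemma gam_nonneg {β w : ℝ} : 0 ≤ gam β w := by
  unfold gam
  split_ifs with h
  · norm_num
  · push Not at h
    have := Real.log_nonneg h.le
    have : 0 < w - 1 := by linarith
    positivity

lemma gam_le {β w : ℝ} (hw : 1 ≤ w) : gam β w ≤ w ^ (-β) * (1 + Real.log w) := by
  unfold gam
  split_ifs with h
  · have : w = 1 := le_antisymm h hw
    simp [this]
  · push Not at h
    have h0 : 0 < w := by linarith
    have h1 : 0 < w - 1 := by linarith
    rw [sub_eq_neg_add, Real.rpow_add h0, Real.rpow_one, mul_assoc]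
    gcongr
    rw [← mul_div_assoc, div_le_iff₀ h1]
    have := Real.log_le_sub_one_of_pos h0
    nlinarith

lemma logdiv_anti {w w' : ℝ} (hw : 1 < w) (hww : w ≤ w') :
    Real.log w' / (w' - 1) ≤ Real.log w / (w - 1) := by
  have h1 : 0 < w - 1 := by linarith
  have h2 : 0 < w' - 1 := by linarith
  rw [div_le_div_iff₀ h2 h1]
  have := strictConcaveOn_log_Ioi.concaveOn.2 (Set.mem_Ioi.2 one_pos)
      (Set.mem_Ioi.2 (by linarith : 0 < w'))
      (div_nonneg (by linarith : 0 ≤ w' - w) h2.le) (div_nonneg h1.le h2.le) (by field_simp; ring)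
  simp only [smul_eq_mul, Real.log_one, mul_zero, zero_add] at this
  have e : (w' - w) / (w' - 1) * 1 + (w - 1) / (w' - 1) * w' = w := by field_simp; ring
  rw [e, div_mul_eq_mul_div, div_le_iff₀ h2] at this
  linarith

lemma gam_anti {β w w' : ℝ} (hβ : 1 ≤ β) (hw : 1 ≤ w) (hww : w ≤ w') : gam β w' ≤ gam β w := by
  unfold gam
  split_ifs with h h' h'
  · exact le_rfl
  · exfalso; linarith
  · push Not at h
    have h2 : 0 < w' - 1 := by linarith
    have a1 : w' ^ (1 - β) ≤ 1 := Real.rpow_le_one_of_one_le_of_nonpos h.le (by linarith)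
    have a2 : Real.log w' / (w' - 1) ≤ 1 := by
      rw [div_le_one h2]; exact Real.log_le_sub_one_of_pos (by linarith)
    have a3 : 0 ≤ Real.log w' / (w' - 1) := div_nonneg (Real.log_nonneg h.le) h2.le
    have a4 : 0 ≤ w' ^ (1 - β) := by positivity
    nlinarith
  · push Not at h h'
    have h2 : 0 < w' - 1 := by linarith
    apply mul_le_mul
    · exact Real.rpow_le_rpow_of_nonpos (by linarith) hww (by linarith)
    · exact logdiv_anti h' hww
    · exact div_nonneg (Real.log_nonneg h.le) h2.le
    · have : 0 < w := by linarith
      positivity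

lemma gam_key {β w s : ℝ} (hβ : 1 ≤ β) (hw : 1 ≤ w) (hs0 : 0 ≤ s) (hs : s < 1) :
    gam β w + w ^ (-β) * ((β - 1) * s * (Real.log w + 1) - ((1 - s) ^ (-β) - 1))
      ≤ (1 - s) * gam β (1 + (1 - s) * (w - 1)) := by
  rcases hw.eq_or_lt with rfl | hw
  · have := rpow_tangent (a := β) (z := 1 - s) (by linarith) (by linarith)
    simp [gam]
    nlinarith
  have hy : 0 < w - 1 := by linarith
  have ht : 0 < 1 - s := by linarith
  have h0 : 0 < w := by linarith
  have hty : 0 < (1 - s) * (w - 1) := by positivity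
  unfold gam
  rw [if_neg (by linarith), if_neg (by linarith)]
  obtain ⟨u, hu⟩ : ∃ u, u = (w - 1) / w := ⟨_, rfl⟩
  have hu0 : 0 ≤ u := by rw [hu]; positivity
  have hu1 : u ≤ 1 := by rw [hu, div_le_one h0]; linarith
  have hz : 0 < 1 - s * u := by nlinarith
  have e1 : 1 + (1 - s) * (w - 1) = w * (1 - s * u) := by rw [hu]; field_simp; ring
  have e2 : Real.log (w * (1 - s * u)) = Real.log w + Real.log (1 - s * u) :=
    Real.log_mul h0.ne' hz.ne'
  have claim : Real.log w + u * ((β - 1) * s * (Real.log w + 1) - ((1 - s) ^ (-β) - 1))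
      ≤ (1 - s * u) ^ (1 - β) * (Real.log w + Real.log (1 - s * u)) := by
    have c1 := Real.one_sub_inv_le_log_of_pos hz
    have c2 := rpow_chord (β := β) (by linarith) hs hs0 hu0 hu1
    have c3 := rpow_tangent (a := β - 1) (z := 1 - s * u) (by linarith) hz
    rw [neg_sub] at c3
    have c4 : (1 - s * u) ^ (1 - β) * (1 - s * u)⁻¹ = (1 - s * u) ^ (-β) := by
      rw [← Real.rpow_neg_one, ← Real.rpow_add hz]; congr 1; ring
    have c5 : 0 < (1 - s * u) ^ (1 - β) := by positivity
    have c6 := mul_le_mul_of_nonneg_left c1 c5.le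
    have c7 := Real.log_nonneg hw.le
    have c8 : (1 + (β - 1) * (1 - (1 - s * u))) * (Real.log w + 1) ≤
      (1 - s * u) ^ (1 - β) * (Real.log w + 1) := mul_le_mul_of_nonneg_right c3 (by linarith)
    rw [mul_sub, c4] at c6
    nlinarith
  have e3 : (1 + (1 - s) * (w - 1)) - 1 = (1 - s) * (w - 1) := by ring
  rw [e3, e1, e2, Real.mul_rpow h0.le hz.le]
  have e4 : (1 - s) * (w ^ (1 - β) * (1 - s * u) ^ (1 - β) *
      ((Real.log w + Real.log (1 - s * u)) / ((1 - s) * (w - 1)))) =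
      w ^ (1 - β) / (w - 1) * ((1 - s * u) ^ (1 - β) * (Real.log w + Real.log (1 - s * u))) := by
    field_simp
  have e5 : w ^ (-β) = w ^ (1 - β) / (w - 1) * u := by
    rw [hu, sub_eq_neg_add 1 β, Real.rpow_add h0, Real.rpow_one]; field_simp
  rw [e4, e5]
  refine le_trans (le_of_eq ?_) (mul_le_mul_of_nonneg_left claim (by positivity))
  field_simp

lemma deriv_step {n β G A P : ℝ}
    (h : ∀ s : ℝ, 0 ≤ s → s < 1 →
      G + (β - 1) * s * (A + P) - ((1 - s) ^ (-β) - 1) * P ≤ (1 - s) ^ (1 - n) * G) :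
    (β - 1) * (A + P) - β * P ≤ (n - 1) * G := by
  let H : ℝ → ℝ := fun s => (1 - s) ^ (1 - n) * G -
    (G + (β - 1) * s * (A + P) - ((1 - s) ^ (-β) - 1) * P)
  have hb : HasDerivAt (fun s : ℝ => 1 - s) (-1) 0 := by
    simpa using (hasDerivAt_id (0 : ℝ)).const_sub 1
  have hd : HasDerivAt H ((n - 1) * G - ((β - 1) * (A + P) - β * P)) 0 := by
    have h1 := (hb.rpow_const (p := 1 - n) (Or.inl (by norm_num))).mul_const G
    have h2 := ((hb.rpow_const (p := -β) (Or.inl (by norm_num))).sub_const 1).mul_const P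
    have h3 := (((hasDerivAt_id (0 : ℝ)).const_mul (β - 1)).mul_const (A + P)).const_add G
    refine (h1.sub (h3.sub h2)).congr_deriv ?_
    simp only [sub_zero, Real.one_rpow]
    ring
  have ht := hd.tendsto_slope_zero_right
  have : 0 ≤ (n - 1) * G - ((β - 1) * (A + P) - β * P) := by
    refine ge_of_tendsto ht ?_
    filter_upwards [Ioo_mem_nhdsGT (zero_lt_one' ℝ)] with s hs
    have h0 : H 0 = 0 := by simp [H]
    have h1 : 0 ≤ H s := sub_nonneg.2 (h s hs.1.le hs.2)
    rw [zero_add, h0, sub_zero, smul_eq_mul]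
    exact mul_nonneg (inv_nonneg.2 hs.1.le) h1
  linarith

lemma int_scale {n : ℕ} (F : (Fin n → ℝ) → ℝ) (x0 : Fin n → ℝ) {t : ℝ} (ht : 0 ≤ t) :
    ∫ x, F (x0 + t • (x - x0)) = (t ^ n)⁻¹ * ∫ x, F x := by
  rw [integral_sub_right_eq_self (fun y => F (x0 + t • y)) x0,
    Measure.integral_comp_smul_of_nonneg volume (fun y => F (x0 + y)) t (hR := ht),
    integral_add_left_eq_self F x0]
  simp

lemma measurable_gam (β : ℝ) : Measurable (gam β) := by
  unfold gam
  refine Measurable.ite measurableSet_Iic measurable_const ?_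
  fun_prop

lemma main_step (n : ℕ) (hn : 1 ≤ n) (β : ℝ)
    (hβ1 : (n : ℝ) + 1 ≤ β)
    (f V : (Fin n → ℝ) → ℝ)
    (hnn : ∀ x, 0 ≤ f x) (hpdf : ∫ x, f x = 1)
    (hV : ConvexOn ℝ {x | 0 < f x} V)
    (hform : ∀ x, 0 < f x → 0 < V x ∧ f x = V x ^ (-β))
    (hent : Integrable fun x => f x * Real.log (f x)) (x0 : Fin n → ℝ) (hx0 : 0 < f x0) :
    Real.log (f x0) - ∫ x, f x * Real.log (f x) ≤ β * (n / (β - n)) := by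
  have hnR : (1 : ℝ) ≤ n := by exact_mod_cast hn
  have hβ : 1 ≤ β := by linarith
  have hβ0 : 0 < β := by linarith
  have hfi : Integrable f := by
    by_contra h
    rw [integral_undef h] at hpdf
    norm_num at hpdf
  obtain ⟨M, hM⟩ : ∃ M, M = f x0 := ⟨_, rfl⟩
  rw [← hM] at hx0 ⊢
  obtain ⟨v0, hv0⟩ : ∃ v0, v0 = V x0 := ⟨_, rfl⟩
  have hv0p : 0 < v0 := by rw [hv0]; exact (hform x0 (hM ▸ hx0)).1
  have hMv : M = v0 ^ (-β) := by rw [hv0, hM]; exact (hform x0 (hM ▸ hx0)).2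
  let p : (Fin n → ℝ) → ℝ := fun x => min (f x) M / M
  let q : (Fin n → ℝ) → ℝ := fun x => p x * Real.log (p x)
  let W : (Fin n → ℝ) → ℝ := fun x => max (V x / v0) 1
  let F : (Fin n → ℝ) → ℝ := fun x => if 0 < f x then gam β ((p x) ^ (-1 / β)) else 0
  have hW1 : ∀ x, 1 ≤ W x := fun x => le_max_right _ _
  have hp0 : ∀ x, 0 ≤ p x := fun x => div_nonneg (le_min (hnn x) hx0.le) hx0.le
  have hp1 : ∀ x, p x ≤ 1 := fun x => by
    simp only [p]; rw [div_le_one hx0]; exact min_le_right _ _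
  -- `p = W ^ (-β)` on the support
  have hpW : ∀ x, 0 < f x → p x = W x ^ (-β) := by
    intro x hx
    obtain ⟨hVx, hfx⟩ := hform x hx
    have e : f x / M = (V x / v0) ^ (-β) := by
      rw [hfx, hMv, Real.div_rpow hVx.le hv0p.le]
    have hq : 0 < V x / v0 := by positivity
    simp only [p, W]
    rcases le_total (V x / v0) 1 with h | h
    · rw [max_eq_right h, Real.one_rpow, min_eq_right, div_self hx0.ne']
      rw [← one_le_div hx0, e]
      exact Real.one_le_rpow_of_pos_of_le_one_of_nonpos hq h (by linarith)
    · rw [max_eq_left h, min_eq_left, e]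
      rw [← div_le_one hx0, e]
      exact Real.rpow_le_one_of_one_le_of_nonpos h (by linarith)
  have hFW : ∀ x, 0 < f x → F x = gam β (W x) := by
    intro x hx
    have : (0 : ℝ) < W x := lt_of_lt_of_le one_pos (hW1 x)
    simp only [F]
    rw [if_pos hx, hpW x hx, ← Real.rpow_mul this.le]
    congr 1
    have : -β * (-1 / β) = 1 := by field_simp
    rw [this, Real.rpow_one]
  have hqW : ∀ x, 0 < f x → Real.log (W x) * p x = -q x / β := by
    intro x hx
    have : (0 : ℝ) < W x := lt_of_lt_of_le one_pos (hW1 x)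
    simp only [q]
    rw [hpW x hx, Real.log_rpow this]
    field_simp
  have hpz : ∀ x, ¬ 0 < f x → p x = 0 := by
    intro x hx
    have : f x = 0 := le_antisymm (not_lt.1 hx) (hnn x)
    simp only [p]
    rw [this, min_eq_left hx0.le, zero_div]
  have hFnn : ∀ x, 0 ≤ F x := by
    intro x
    simp only [F]
    split_ifs
    · exact gam_nonneg
    · exact le_rfl
  have hFle : ∀ x, F x ≤ -q x / β + p x := by
    intro x
    by_cases hx : 0 < f x
    · rw [hFW x hx, ← hqW x hx]
      have := gam_le (β := β) (hW1 x)
      rw [← hpW x hx] at this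
      linarith
    · simp [F, q, hpz x hx, hx]
  have hkey : ∀ s : ℝ, 0 ≤ s → s < 1 → ∀ x,
      F x + (β - 1) * s * (-q x / β + p x) - ((1 - s) ^ (-β) - 1) * p x
        ≤ (1 - s) * F (x0 + (1 - s) • (x - x0)) := by
    intro s hs0 hs1 x
    by_cases hx : 0 < f x
    · have hx0K : 0 < f x0 := hM ▸ hx0
      have hz : x0 + (1 - s) • (x - x0) = s • x0 + (1 - s) • x := by
        rw [smul_sub, sub_smul, sub_smul]; simp only [one_smul]; abel
      have hzK : 0 < f (s • x0 + (1 - s) • x) :=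
        hV.1 hx0K hx hs0 (by linarith) (by ring)
      have hVz := hV.2 hx0K hx hs0 (by linarith : 0 ≤ 1 - s) (by ring)
      rw [hz, hFW _ hzK, hFW x hx, ← hqW x hx]
      have hWz : W (s • x0 + (1 - s) • x) ≤ 1 + (1 - s) * (W x - 1) := by
        apply max_le
        · rw [div_le_iff₀ hv0p]
          simp only [smul_eq_mul] at hVz
          rw [← hv0] at hVz
          have : V x ≤ W x * v0 := (div_le_iff₀ hv0p).1 (le_max_left _ _)
          nlinarith
        · have := hW1 x
          nlinarith
      have k1 := gam_anti hβ (hW1 _) hWz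
      have k2 := gam_key hβ (hW1 x) hs0 hs1
      rw [← hpW x hx] at k2
      have k3 := mul_le_mul_of_nonneg_left k1 (by linarith : 0 ≤ 1 - s)
      linarith
    · have := mul_nonneg (by linarith : 0 ≤ 1 - s) (hFnn (x0 + (1 - s) • (x - x0)))
      have hF0 : F x = 0 := by simp [F, hx]
      have hq0 : q x = 0 := by simp [q, hpz x hx]
      rw [hF0, hq0, hpz x hx]
      simpa using this
  -- integrability
  have hfm : AEMeasurable f := hfi.1.aemeasurable
  have hpm : AEMeasurable p := (hfm.min aemeasurable_const).div_const M
  have hpi : Integrable p := by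
    refine (hfi.div_const M).mono' hpm.aestronglyMeasurable (ae_of_all _ fun x => ?_)
    rw [Real.norm_of_nonneg (hp0 x)]
    simp only [p]
    gcongr
    exact min_le_left _ _
  -- comparison of `q` with the entropy integrand
  have hqle : ∀ x, f x * Real.log M - f x * Real.log (f x) ≤ -(M * q x) := by
    intro x
    rcases (hnn x).eq_or_lt with hx | hx
    · simp [q, hpz x (by rw [← hx]; exact lt_irrefl _), ← hx]
    rcases le_total (f x) M with h | h
    · have : p x = f x / M := by simp only [p]; rw [min_eq_left h]
      simp only [q]
      rw [this, Real.log_div hx.ne' hx0.ne']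
      apply le_of_eq; field_simp; ring
    · have : p x = 1 := by simp only [p]; rw [min_eq_right h, div_self hx0.ne']
      have := Real.log_le_log hx0 h
      simp only [q]
      rw [‹p x = 1›]
      simp
      nlinarith
  have hqbd : ∀ x, ‖q x‖ ≤ (‖f x * Real.log M‖ + ‖f x * Real.log (f x)‖) / M := by
    intro x
    rw [le_div_iff₀ hx0]
    rcases (hnn x).eq_or_lt with hx | hx
    · simp [q, hpz x (by rw [← hx]; exact lt_irrefl _), ← hx]
    rcases le_total (f x) M with h | h
    · have : p x = f x / M := by simp only [p]; rw [min_eq_left h]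
      have e : ‖q x‖ * M = ‖f x * Real.log (f x) - f x * Real.log M‖ := by
        rw [← Real.norm_of_nonneg hx0.le, ← norm_mul, Real.norm_of_nonneg hx0.le]
        congr 1
        simp only [q]
        rw [this, Real.log_div hx.ne' hx0.ne']
        field_simp
      rw [e, add_comm]
      exact norm_sub_le _ _
    · have : p x = 1 := by simp only [p]; rw [min_eq_right h, div_self hx0.ne']
      simp only [q]
      rw [this]
      simp
      positivity
  have hqm : AEMeasurable q := hpm.mul hpm.log
  have hqi : Integrable q :=
    (((hfi.mul_const (Real.log M)).norm.add hent.norm).div_const M).mono'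
      hqm.aestronglyMeasurable (ae_of_all _ hqbd)
  have hqp : Integrable fun x => -q x / β + p x := (hqi.neg.div_const β).add hpi
  have hFm : AEMeasurable F := by
    have : Measurable fun y : ℝ => if 0 < y then gam β ((min y M / M) ^ (-1 / β)) else 0 := by
      refine Measurable.ite measurableSet_Ioi ((measurable_gam β).comp ?_) measurable_const
      fun_prop
    exact this.comp_aemeasurable hfm
  have hFi : Integrable F :=
    hqp.mono' hFm.aestronglyMeasurable (ae_of_all _ fun x => by
      rw [Real.norm_of_nonneg (hFnn x)]; exact hFle x)
  have hsumInt : (∫ x, (-q x / β + p x)) = (∫ x, -q x / β) + ∫ x, p x :=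
    integral_add (hqi.neg.div_const β) hpi
  have hG : (∫ x, F x) ≤ (∫ x, -q x / β) + ∫ x, p x := by
    rw [← hsumInt]; exact integral_mono hFi hqp hFle
  have hstep := deriv_step (n := n) (β := β) (G := ∫ x, F x) (A := ∫ x, -q x / β) (P := ∫ x, p x) (by
    intro s hs0 hs1
    have ht : 0 < 1 - s := by linarith
    have hi2 : Integrable fun x => F (x0 + (1 - s) • (x - x0)) :=
      ((hFi.comp_add_left x0).comp_smul ht.ne').comp_sub_right x0
    have i1 : Integrable fun x => (β - 1) * s * (-q x / β + p x) := hqp.const_mul _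
    have i2 : Integrable fun x => ((1 - s) ^ (-β) - 1) * p x := hpi.const_mul _
    have i3 : Integrable fun x => F x + (β - 1) * s * (-q x / β + p x) := hFi.add i1
    have := integral_mono (i3.sub i2) (hi2.const_mul (1 - s)) (hkey s hs0 hs1)
    simp only [Pi.sub_apply] at this
    rw [integral_sub i3 i2, integral_add hFi i1, integral_const_mul, integral_const_mul,
      integral_const_mul, hsumInt, int_scale F x0 ht.le] at this
    rw [Real.rpow_sub ht, Real.rpow_one, Real.rpow_natCast]
    refine this.trans (le_of_eq ?_)
    field_simp)
  have hP : M * (∫ x, p x) ≤ 1 := by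
    rw [← integral_const_mul, ← hpdf]
    refine integral_mono (hpi.const_mul M) hfi fun x => ?_
    simp only [p]
    rw [mul_div_cancel₀ _ hx0.ne']
    exact min_le_left _ _
  have hA : Real.log M - ∫ x, f x * Real.log (f x) ≤ M * β * ∫ x, -q x / β := by
    have e1 : (∫ x, (f x * Real.log M - f x * Real.log (f x))) =
        Real.log M - ∫ x, f x * Real.log (f x) := by
      rw [integral_sub (hfi.mul_const _) hent, integral_mul_const, hpdf, one_mul]
    rw [← e1, ← integral_const_mul]
    refine integral_mono ((hfi.mul_const _).sub hent) ((hqi.neg.div_const β).const_mul _) fun x => ?_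
    refine (hqle x).trans (le_of_eq ?_)
    field_simp
  refine hA.trans ?_
  generalize (∫ x, -q x / β) = A at *
  generalize (∫ x, p x) = P at *
  have hbn : 0 < β - n := by linarith
  have f1 : (β - n) * A ≤ n * P := by nlinarith
  have f2 : M * A ≤ n / (β - n) := by
    rw [le_div_iff₀ hbn]
    nlinarith
  nlinarith

/-- For a random vector `X` in ℝⁿ with density `f = V^{−β}` (`V` positive convex on the
support, `β ≥ n+1`, `β ≥ β₀ n`, `β₀ > 1`):
`h(X) ≤ (β₀/(β₀−1)) n + log (1/‖f‖_∞)`. -/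
theorem stmt_17 (n : ℕ) (β β₀ : ℝ) (hβ₀ : 1 < β₀)
    (hβ1 : (n : ℝ) + 1 ≤ β) (hβ2 : β₀ * n ≤ β)
    (f V : (Fin n → ℝ) → ℝ)
    (hnn : ∀ x, 0 ≤ f x) (hpdf : ∫ x, f x = 1)
    (hV : ConvexOn ℝ {x | 0 < f x} V)
    (hform : ∀ x, 0 < f x → 0 < V x ∧ f x = V x ^ (-β))
    (hent : Integrable fun x => f x * Real.log (f x)) :
    -∫ x, f x * Real.log (f x) ≤ (β₀ / (β₀ - 1)) * n + Real.log (1 / ⨆ x, f x) := by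
  rcases Nat.eq_zero_or_pos n with rfl | hn
  · have hf : f default = 1 := by
      rw [Measure.volume_pi_eq_dirac default, integral_dirac] at hpdf
      exact hpdf
    rw [Measure.volume_pi_eq_dirac default, integral_dirac]
    have hf' : ∀ x, f x = 1 := fun x => by rw [← hf]; congr 1; exact Subsingleton.elim _ _
    simp [hf']
  have hbn : 0 < β - n := by linarith
  have hb1 : 0 < β₀ - 1 := by linarith
  have hc : β * (n / (β - n)) ≤ β₀ / (β₀ - 1) * n := by
    have : β / (β - n) ≤ β₀ / (β₀ - 1) := by
      rw [div_le_div_iff₀ hbn hb1]; nlinarith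
    calc β * (n / (β - n)) = β / (β - n) * n := by ring
      _ ≤ _ := by gcongr
  have hpt : ∀ x, f x ≤ Real.exp (β₀ / (β₀ - 1) * n + ∫ x, f x * Real.log (f x)) := by
    intro x
    rcases (hnn x).eq_or_lt with hx | hx
    · rw [← hx]; positivity
    · rw [← Real.log_le_iff_le_exp hx]
      have := main_step n hn β hβ1 f V hnn hpdf hV hform hent x hx
      linarith
  obtain ⟨x1, hx1⟩ : ∃ x, 0 < f x := by
    by_contra! h
    have : f = fun _ => 0 := funext fun x => le_antisymm (h x) (hnn x)
    rw [this] at hpdf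
    simp at hpdf
  have hsup : 0 < ⨆ x, f x :=
    lt_of_lt_of_le hx1 (le_ciSup ⟨_, Set.forall_mem_range.2 hpt⟩ x1)
  have := (Real.log_le_iff_le_exp hsup).2 (ciSup_le hpt)
  rw [one_div, Real.log_inv]
  linarith
end

section
/- Let X and Y be independent identically distributed random vectors in ℝⁿ with finite entropy, and suppose X−Y has a density of the form V^{−β} with V positive convex and β ≥ max(n+1, β₀ n) for some β₀ > 1. Then H(X−Y) ≤ D·H(X) and H(X+Y) ≤ D²·H(X), where D = exp(2β₀/(β₀−1)) and H(W) = e^{2h(W)/n}. -/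
open MeasureTheory Real

noncomputable def Fn (β v : ℝ) : ℝ := v ^ (1 - β) * (if v = 1 then 1 else Real.log v / (v - 1))

lemma log_div_anti {v w : ℝ} (hv : 1 < v) (hw : v ≤ w) :
    Real.log w / (w - 1) ≤ Real.log v / (v - 1) := by
  rcases eq_or_lt_of_le hw with rfl | hw
  · exact le_rfl
  have hv1 : 0 < v - 1 := by linarith
  have hw1 : 0 < w - 1 := by linarith
  obtain ⟨-, hc⟩ := strictConcaveOn_log_Ioi.concaveOn
  have := @hc 1 (by simp) w (by simp; linarith)
    ( (w - v) / (w - 1)) ((v - 1) / (w - 1)) (div_nonneg (by linarith) hw1.le)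
    (div_nonneg hv1.le hw1.le) (by field_simp; ring)
  simp only [smul_eq_mul, Real.log_one, mul_zero, zero_add, mul_one] at this
  rw [show (w - v) / (w - 1) + (v - 1) / (w - 1) * w = v by field_simp; ring] at this
  rw [le_div_iff₀ hv1]
  calc _ = (v - 1) / (w - 1) * Real.log w := by ring
    _ ≤ _ := this

lemma Fn_anti {β v w : ℝ} (hβ : 1 ≤ β) (hv : 1 ≤ v) (hw : v ≤ w) : Fn β w ≤ Fn β v := by
  unfold Fn
  have h1 : w ^ (1 - β) ≤ v ^ (1 - β) :=
    Real.rpow_le_rpow_of_nonpos (by linarith) hw (by linarith)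
  have hw1 : 1 ≤ w := hv.trans hw
  refine mul_le_mul h1 ?_ ?_ (by positivity)
  · rcases eq_or_lt_of_le hv with rfl | hv
    · simp only [if_true]
      split_ifs with h
      · exact le_rfl
      · have : 0 < w - 1 := by
          rcases lt_or_eq_of_le hw1 with h' | h'
          · linarith
          · exact absurd h'.symm h
        rw [div_le_one this]
        exact Real.log_le_sub_one_of_pos (by linarith)
    · rw [if_neg (by linarith), if_neg (by linarith)]
      exact log_div_anti hv hw
  · split_ifs
    · norm_num
    · exact div_nonneg (Real.log_nonneg hw1) (by linarith)

lemma Fn_nonneg {β v : ℝ} (hv : 1 ≤ v) : 0 ≤ Fn β v := by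
  unfold Fn
  refine mul_nonneg (by positivity) ?_
  split_ifs
  · norm_num
  · exact div_nonneg (Real.log_nonneg hv) (by linarith)

lemma Fn_le {β v : ℝ} (hv : 1 ≤ v) : Fn β v ≤ v ^ (-β) * (1 + Real.log v) := by
  unfold Fn
  have h0 : v ^ (1 - β) = v ^ (-β) * v := by
    rw [show 1 - β = -β + 1 by ring, Real.rpow_add (by linarith), Real.rpow_one]
  rw [h0, mul_assoc]
  refine mul_le_mul_of_nonneg_left ?_ (by positivity)
  split_ifs with h
  · subst h; simp
  · have : 0 < v - 1 := by
      rcases lt_or_eq_of_le hv with h' | h'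
      · linarith
      · exact absurd h'.symm h
    rw [mul_div_assoc', div_le_iff₀ this]
    have := Real.log_le_sub_one_of_pos (show 0 < v by linarith)
    nlinarith

lemma Fn_scale (m : ℕ) {β v l : ℝ} (hβ : (m : ℝ) + 1 < β) (hv : 1 ≤ v) (hl0 : 0 < l) (hl1 : l < 1) :
    Fn β v - l ^ (m + 1) * Fn β (1 + l * (v - 1)) ≤
      (1 - l) * (v ^ (-β) * ((m + 1) * l ^ (-β) - l ^ m * (β - (m + 1)) * (Real.log v + Real.log l))) := by
  have hm0 : (0 : ℝ) ≤ m := Nat.cast_nonneg m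
  have hlog : Real.log l < 0 := Real.log_neg hl0 hl1
  have hlb : 1 ≤ l ^ (-β) := Real.one_le_rpow_of_pos_of_le_one_of_nonpos hl0 hl1.le (by linarith)
  rcases eq_or_lt_of_le hv with rfl | hv
  · have h1 : 1 - l ^ (m + 1) ≤ (1 - l) * (m + 1) := by
      have := one_add_mul_le_pow (a := l - 1) (by linarith) (m + 1)
      push_cast at this
      rw [show 1 + (l - 1) = l by ring] at this
      linarith
    simp only [Fn, sub_self, mul_zero, add_zero, Real.one_rpow, if_true, mul_one, Real.log_one, zero_add, one_mul]
    refine h1.trans (mul_le_mul_of_nonneg_left ?_ (by linarith))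
    have : 0 ≤ l ^ m * (β - (m + 1)) * (-Real.log l) := by
      apply mul_nonneg (mul_nonneg (by positivity) (by linarith)) (by linarith)
    nlinarith
  set w := 1 + l * (v - 1) with hw
  have hw1 : 1 < w := by have : 0 < l * (v - 1) := mul_pos hl0 (by linarith); linarith
  have hwv : w < v := by nlinarith
  have hlw : l * v ≤ w := by nlinarith
  have hd : ∀ t : ℝ, 1 < t → HasDerivAt (fun t : ℝ => (t - 1) ^ m * (t ^ (1 - β) * Real.log t))
      ((m * (t - 1) ^ (m - 1) * 1) * (t ^ (1 - β) * Real.log t) + (t - 1) ^ m *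
        ((1 - β) * t ^ (1 - β - 1) * Real.log t + t ^ (1 - β) * t⁻¹)) t := by
    intro t ht
    have ht0 : t ≠ 0 := by linarith
    exact (((hasDerivAt_id t).sub_const 1).pow m).mul
      ((Real.hasDerivAt_rpow_const (Or.inl ht0)).mul (Real.hasDerivAt_log ht0))
  obtain ⟨z, ⟨hz1, hz2⟩, hz⟩ := exists_hasDerivAt_eq_slope _ _ hwv
    (fun t ht => (hd t (lt_of_lt_of_le hw1 ht.1)).continuousAt.continuousWithinAt)
    (fun t ht => hd t (hw1.trans ht.1))
  have hz0 : 1 < z := hw1.trans hz1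
  have hLz : 0 ≤ Real.log z := Real.log_nonneg hz0.le
  have hLz1 : Real.log z ≤ z - 1 := Real.log_le_sub_one_of_pos (by linarith)
  have hzb : 0 < z ^ (-β) := Real.rpow_pos_of_pos (by linarith) _
  have e1 : z ^ (1 - β) = z ^ (-β) * z := by
    rw [show 1 - β = -β + 1 by ring, Real.rpow_add (by linarith), Real.rpow_one]
  have e2 : z ^ (1 - β - 1) = z ^ (-β) := by ring_nf
  have hder : (m * (z - 1) ^ (m - 1) * 1) * (z ^ (1 - β) * Real.log z) + (z - 1) ^ m *
        ((1 - β) * z ^ (1 - β - 1) * Real.log z + z ^ (1 - β) * z⁻¹) ≤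
      (z - 1) ^ m * (z ^ (-β) * ((m + 1) - (β - (m + 1)) * Real.log z)) := by
    rw [e2, e1]
    have e3 : z ^ (-β) * z * z⁻¹ = z ^ (-β) := by field_simp
    rw [e3]
    rcases m with _ | k
    · apply le_of_eq; simp; ring
    · have : 0 ≤ (k + 1) * (z - 1) ^ k * z ^ (-β) * ((z - 1) - Real.log z) := by
        have : 0 ≤ z - 1 := by linarith
        have : 0 ≤ (z - 1) - Real.log z := by linarith
        positivity
      simp only [Nat.add_sub_cancel, pow_succ]
      push_cast
      nlinarith
  have hvp : 0 < v - 1 := by linarith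
  have hF : Fn β v - l ^ (m + 1) * Fn β w = (1 - l) * (((v - 1) ^ m * (v ^ (1 - β) * Real.log v)
      - (w - 1) ^ m * (w ^ (1 - β) * Real.log w)) / (v - w)) / (v - 1) ^ m := by
    have hwe : w - 1 = l * (v - 1) := by rw [hw]; ring
    have hvw : v - w = (1 - l) * (v - 1) := by rw [hw]; ring
    unfold Fn
    rw [if_neg hv.ne', if_neg hw1.ne', hwe, hvw]
    have : 1 - l ≠ 0 := by linarith
    field_simp
    rw [mul_pow]; ring
  rw [hF, ← hz, mul_div_assoc]
  refine mul_le_mul_of_nonneg_left ?_ (by linarith)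
  have hvm : 0 < (v - 1) ^ m := by positivity
  rw [div_le_iff₀ hvm]
  refine hder.trans ?_
  have a1 : (z - 1) ^ m ≤ (v - 1) ^ m := pow_le_pow_left₀ (by linarith) (by linarith) m
  have a2 : l ^ m * (v - 1) ^ m ≤ (z - 1) ^ m := by
    rw [← mul_pow]; apply pow_le_pow_left₀ (by positivity)
    rw [hw] at hz1; linarith
  have a3 : z ^ (-β) ≤ v ^ (-β) * l ^ (-β) := by
    rw [← Real.mul_rpow (by linarith) hl0.le]
    apply Real.rpow_le_rpow_of_nonpos (by positivity) _ (by linarith)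
    linarith
  have a4 : v ^ (-β) ≤ z ^ (-β) :=
    Real.rpow_le_rpow_of_nonpos (by linarith) hz2.le (by linarith)
  have a5 : Real.log v + Real.log l ≤ Real.log z := by
    rw [← Real.log_mul (by linarith) hl0.ne']
    apply Real.log_le_log (by positivity); linarith
  have hvb : 0 < v ^ (-β) := Real.rpow_pos_of_pos (by linarith) _
  have b1 : (z - 1) ^ m * z ^ (-β) ≤ (v - 1) ^ m * (v ^ (-β) * l ^ (-β)) := by gcongr
  have b2 : (l ^ m * (v - 1) ^ m) * v ^ (-β) * (Real.log v + Real.log l) ≤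
      (z - 1) ^ m * z ^ (-β) * Real.log z := by
    refine (mul_le_mul_of_nonneg_left a5 (by positivity)).trans ?_
    gcongr
  have c1 := mul_le_mul_of_nonneg_left b1 (show (0:ℝ) ≤ m + 1 by linarith)
  have c2 := mul_le_mul_of_nonneg_left b2 (show (0:ℝ) ≤ β - (m + 1) by linarith)
  nlinarith

lemma key (m : ℕ) {β : ℝ} (hβ : (m : ℝ) + 1 < β) (f V : (Fin (m + 1) → ℝ) → ℝ)
    (hfm : Measurable f) (hfnn : ∀ x, 0 ≤ f x) (hfi : Integrable f) (hf1 : ∫ x, f x = 1)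
    (hf0 : 0 < f 0) (hmax : ∀ x, f x ≤ f 0)
    (hV : ConvexOn ℝ {x | 0 < f x} V)
    (hform : ∀ x, 0 < f x → 0 < V x ∧ f x = V x ^ (-β))
    (h2 : Integrable fun x => f x * Real.log (f x)) :
    -∫ x, f x * Real.log (f x) ≤ -Real.log (f 0) + (m + 1) * β / (β - (m + 1)) := by
  have hm0 : (0 : ℝ) ≤ m := Nat.cast_nonneg m
  have hβ0 : 0 < β := by linarith
  set u : (Fin (m + 1) → ℝ) → ℝ := fun x => (f x / f 0) ^ (-β⁻¹) with hu
  have hum : Measurable u := (hfm.div_const _).pow_const _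
  have V0 := (hform 0 hf0).1
  have huV : ∀ x, 0 < f x → u x = V x / V 0 := by
    intro x hx
    obtain ⟨hv, e⟩ := hform x hx
    have e0 := (hform 0 hf0).2
    simp only [hu]
    rw [e, e0, ← Real.div_rpow hv.le V0.le, ← Real.rpow_mul (by positivity)]
    rw [show -β * -β⁻¹ = 1 by field_simp, Real.rpow_one]
  have hu1 : ∀ x, 0 < f x → 1 ≤ u x := by
    intro x hx
    apply Real.one_le_rpow_of_pos_of_le_one_of_nonpos (by positivity)
    · rw [div_le_one hf0]; exact hmax x
    · simp [hβ0.le]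
  have hub : ∀ x, 0 < f x → u x ^ (-β) = f x / f 0 := by
    intro x hx
    simp only [hu]
    rw [← Real.rpow_mul (by positivity), show -β⁻¹ * -β = 1 by field_simp, Real.rpow_one]
  have hlogu : ∀ x, f x * Real.log (u x) = -β⁻¹ * (f x * Real.log (f x) - Real.log (f 0) * f x) := by
    intro x
    rcases eq_or_lt_of_le (hfnn x) with h | h
    · rw [← h]; simp
    · simp only [hu]
      rw [Real.log_rpow (by positivity), Real.log_div h.ne' hf0.ne']; ring
  have hlui : Integrable fun x => f x * Real.log (u x) := by
    simp only [hlogu]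
    exact (h2.sub (hfi.const_mul _)).const_mul _
  have hluint : ∫ x, f x * Real.log (u x) = -β⁻¹ * ((∫ x, f x * Real.log (f x)) - Real.log (f 0)) := by
    simp only [hlogu]
    rw [integral_const_mul, integral_sub h2 (hfi.const_mul _), integral_const_mul, hf1, mul_one]
  set g : (Fin (m + 1) → ℝ) → ℝ := fun x => if 0 < f x then Fn β (u x) else 0 with hg
  have hFm : Measurable (Fn β) := by
    unfold Fn
    refine (measurable_id.pow_const _).mul (Measurable.ite (measurableSet_eq) measurable_const ?_)
    exact Real.measurable_log.div (measurable_id.sub_const 1)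
  have hgm : Measurable g :=
    Measurable.ite (measurableSet_lt measurable_const hfm) (hFm.comp hum) measurable_const
  have hgnn : ∀ x, 0 ≤ g x := by
    intro x; simp only [hg]; split_ifs with h
    · exact Fn_nonneg (hu1 x h)
    · exact le_rfl
  have hgi : Integrable g := by
    refine Integrable.mono' ((hfi.add hlui).const_mul (f 0)⁻¹) hgm.aestronglyMeasurable
      (Filter.Eventually.of_forall fun x => ?_)
    rw [Real.norm_of_nonneg (hgnn x)]
    simp only [hg, Pi.add_apply]
    split_ifs with h
    · refine (Fn_le (hu1 x h)).trans (le_of_eq ?_)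
      rw [hub x h]; ring
    · have : f x = 0 := le_antisymm (not_lt.1 h) (hfnn x)
      simp [this]
  have hpt : ∀ l : ℝ, 0 < l → l < 1 → ∀ x, g x - l ^ (m + 1) * g (l • x) ≤
      (1 - l) * (f 0)⁻¹ * (((m + 1) * l ^ (-β) - l ^ m * (β - (m + 1)) * Real.log l) * f x
        - l ^ m * (β - (m + 1)) * (f x * Real.log (u x))) := by
    intro l hl0 hl1 x
    by_cases h : 0 < f x
    · have hcomb : l • x = (1 - l) • (0 : Fin (m + 1) → ℝ) + l • x := by simp
      have hlx : 0 < f (l • x) := by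
        have := hV.1 (show (0 : Fin (m + 1) → ℝ) ∈ {x | 0 < f x} from hf0) (show x ∈ {x | 0 < f x} from h)
          (show 0 ≤ 1 - l by linarith) hl0.le (by ring)
        rw [← hcomb] at this; exact this
      have hVl : V (l • x) ≤ (1 - l) * V 0 + l * V x := by
        have := hV.2 (show (0 : Fin (m + 1) → ℝ) ∈ {x | 0 < f x} from hf0) (show x ∈ {x | 0 < f x} from h)
          (show 0 ≤ 1 - l by linarith) hl0.le (by ring)
        rw [← hcomb] at this; exact this
      have hul : u (l • x) ≤ 1 + l * (u x - 1) := by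
        rw [huV _ hlx, huV _ h, div_le_iff₀ V0]
        have : (1 + l * (V x / V 0 - 1)) * V 0 = (1 - l) * V 0 + l * V x := by field_simp; ring
        rw [this]; exact hVl
      have hF := Fn_anti (β := β) (by linarith) (hu1 _ hlx) hul
      have hS := Fn_scale m hβ (hu1 x h) hl0 hl1
      have : g x - l ^ (m + 1) * g (l • x) ≤ Fn β (u x) - l ^ (m + 1) * Fn β (1 + l * (u x - 1)) := by
        simp only [hg]; rw [if_pos h, if_pos hlx]
        gcongr
      refine (this.trans hS).trans (le_of_eq ?_)
      rw [hub x h]; ring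
    · have h0 : f x = 0 := le_antisymm (not_lt.1 h) (hfnn x)
      have : g x = 0 := by simp only [hg]; rw [if_neg h]
      rw [this, h0]
      have := mul_nonneg (pow_nonneg hl0.le (m+1)) (hgnn (l • x))
      simp; linarith
  set I := ∫ x, f x * Real.log (u x) with hI
  have hineq : ∀ l : ℝ, 0 < l → l < 1 → 0 ≤ ((m + 1) * l ^ (-β) - l ^ m * (β - (m + 1)) * Real.log l)
        - l ^ m * (β - (m + 1)) * I := by
    intro l hl0 hl1
    have hgl : Integrable fun x => g (l • x) := hgi.comp_smul hl0.ne'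
    have h := integral_mono (hgi.sub (hgl.const_mul (l ^ (m + 1))))
      (((hfi.const_mul ((m + 1) * l ^ (-β) - l ^ m * (β - (m + 1)) * Real.log l)).sub
        (hlui.const_mul (l ^ m * (β - (m + 1))))).const_mul ((1 - l) * (f 0)⁻¹)) (hpt l hl0 hl1)
    simp only [Pi.sub_apply] at h
    rw [integral_sub hgi (hgl.const_mul (l ^ (m + 1))), integral_const_mul, integral_const_mul,
      integral_sub (hfi.const_mul _) (hlui.const_mul _), integral_const_mul, integral_const_mul, hf1,
      Measure.integral_comp_smul] at h
    simp only [Module.finrank_fintype_fun_eq_card, Fintype.card_fin, smul_eq_mul] at h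
    rw [abs_of_pos (by positivity), ← mul_assoc, mul_inv_cancel₀ (by positivity), one_mul, sub_self] at h
    have hc : 0 < (1 - l) * (f 0)⁻¹ := mul_pos (by linarith) (by positivity)
    have := nonneg_of_mul_nonneg_right h hc
    linarith
  have hlim : 0 ≤ ((m + 1) * (1:ℝ) ^ (-β) - 1 ^ m * (β - (m + 1)) * Real.log 1)
        - 1 ^ m * (β - (m + 1)) * I := by
    have hc : ContinuousAt (fun l : ℝ => ((m + 1) * l ^ (-β) - l ^ m * (β - (m + 1)) * Real.log l)
        - l ^ m * (β - (m + 1)) * I) 1 := by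
      have h1 : ContinuousAt (fun l : ℝ => l ^ (-β)) 1 :=
        Real.continuousAt_rpow_const _ _ (Or.inl one_ne_zero)
      have h2 : ContinuousAt Real.log 1 := Real.continuousAt_log one_ne_zero
      have h3 : ContinuousAt (fun l : ℝ => l ^ m) 1 := (continuous_pow m).continuousAt
      exact ((continuousAt_const.mul h1).sub ((h3.mul continuousAt_const).mul h2)).sub
        ((h3.mul continuousAt_const).mul continuousAt_const)
    refine ge_of_tendsto (hc.tendsto.mono_left (nhdsWithin_le_nhds (s := Set.Iio 1))) ?_
    have : Set.Ioo (0:ℝ) 1 ∈ nhdsWithin 1 (Set.Iio 1) := Ioo_mem_nhdsLT (by norm_num)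
    filter_upwards [this] with l hl using hineq l hl.1 hl.2
  simp only [Real.one_rpow, one_pow, Real.log_one, mul_zero, sub_zero, mul_one, one_mul] at hlim
  have hb : 0 < β - (m + 1) := by linarith
  rw [hluint] at hlim
  have : (∫ x, f x * Real.log (f x)) - Real.log (f 0) ≥ -((m + 1) * β / (β - (m + 1))) := by
    have h3 : (β - (m + 1)) * (-β⁻¹ * ((∫ x, f x * Real.log (f x)) - Real.log (f 0))) ≤ m + 1 := by linarith
    rw [ge_iff_le, neg_le, le_div_iff₀ hb]
    have h4 := mul_le_mul_of_nonneg_left h3 hβ0.le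
    have h5 : β * ((β - (m + 1)) * (-β⁻¹ * ((∫ x, f x * Real.log (f x)) - Real.log (f 0)))) =
      -((∫ x, f x * Real.log (f x)) - Real.log (f 0)) * (β - (m + 1)) := by
        field_simp
    rw [h5] at h4
    linarith
  linarith

noncomputable def cv {n : ℕ} (A B : (Fin n → ℝ) → ENNReal) (u : Fin n → ℝ) : ENNReal :=
  ∫⁻ y, A (u - y) * B y

lemma cv_meas {n : ℕ} {A B : (Fin n → ℝ) → ENNReal} (hA : Measurable A) (hB : Measurable B) :
    Measurable (cv A B) := by
  unfold cv
  apply Measurable.lintegral_prod_right'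
    (f := fun z : (Fin n → ℝ) × (Fin n → ℝ) => A (z.1 - z.2) * B z.2)
  fun_prop

lemma cv_lint {n : ℕ} {A B : (Fin n → ℝ) → ENNReal} (hA : Measurable A) (hB : Measurable B)
    {φ : (Fin n → ℝ) → ENNReal} (hφ : Measurable φ) :
    ∫⁻ x, ∫⁻ y, A x * (B y * φ (x + y)) = ∫⁻ u, cv A B u * φ u := by
  rw [lintegral_lintegral_swap (by fun_prop)]
  have : ∀ y, ∫⁻ x, A x * (B y * φ (x + y)) = ∫⁻ u, A (u - y) * (B y * φ u) := by
    intro y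
    rw [← lintegral_add_right_eq_self (μ := volume) (fun u => A (u - y) * (B y * φ u)) y]
    simp
  simp only [this]
  rw [lintegral_lintegral_swap (by fun_prop)]
  refine lintegral_congr fun u => ?_
  unfold cv
  rw [← lintegral_mul_const _ (by fun_prop)]
  refine lintegral_congr fun y => ?_
  ring

lemma cv_total {n : ℕ} {A B : (Fin n → ℝ) → ENNReal} (hA : Measurable A) (hB : Measurable B)
    (hA1 : ∫⁻ x, A x = 1) (hB1 : ∫⁻ x, B x = 1) : ∫⁻ u, cv A B u = 1 := by
  have := cv_lint hA hB (φ := fun _ => 1) measurable_const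
  simp only [mul_one] at this
  rw [← this]
  have h : ∀ x, ∫⁻ y, A x * B y = A x := by
    intro x; rw [lintegral_const_mul _ hB, hB1, mul_one]
  simp only [h, hA1]

lemma lint2 {n : ℕ} {A B : (Fin n → ℝ) → ENNReal} (hA : Measurable A) (hB : Measurable B)
    {Φ : (Fin n → ℝ) × (Fin n → ℝ) → ENNReal} (hΦ : Measurable Φ) :
    ∫⁻ w, Φ w ∂((volume.withDensity A).prod (volume.withDensity B)) =
      ∫⁻ x, ∫⁻ y, A x * (B y * Φ (x, y)) := by
  rw [lintegral_prod _ hΦ.aemeasurable, lintegral_withDensity_eq_lintegral_mul _ hA (by fun_prop)]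
  refine lintegral_congr fun x => ?_
  simp only [Pi.mul_apply]
  rw [lintegral_withDensity_eq_lintegral_mul _ hB (by fun_prop), ← lintegral_const_mul _ (by fun_prop)]
  rfl

lemma cv_mp {n : ℕ} {A B : (Fin n → ℝ) → ENNReal} (hA : Measurable A) (hB : Measurable B) :
    MeasurePreserving (fun w : (Fin n → ℝ) × (Fin n → ℝ) => w.1 + w.2)
      ((volume.withDensity A).prod (volume.withDensity B)) (volume.withDensity (cv A B)) := by
  refine ⟨by fun_prop, ?_⟩
  refine Measure.ext_of_lintegral _ fun φ hφ => ?_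
  rw [lintegral_map hφ (by fun_prop), lint2 hA hB (by fun_prop), cv_lint hA hB hφ,
    lintegral_withDensity_eq_lintegral_mul _ (cv_meas hA hB) hφ]
  rfl

lemma neg_mp {n : ℕ} {A : (Fin n → ℝ) → ENNReal} (hA : Measurable A) :
    MeasurePreserving (fun w : (Fin n → ℝ) => -w)
      (volume.withDensity A) (volume.withDensity (fun x => A (-x))) := by
  refine ⟨by fun_prop, ?_⟩
  refine Measure.ext_of_lintegral _ fun φ hφ => ?_
  rw [lintegral_map hφ (by fun_prop), lintegral_withDensity_eq_lintegral_mul _ hA (by fun_prop),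
    lintegral_withDensity_eq_lintegral_mul _ (by fun_prop) hφ,
    ← lintegral_neg_eq_self]
  simp

lemma cv_bound {n : ℕ} {A B : (Fin n → ℝ) → ENNReal} (hA : Measurable A) (hB : Measurable B)
    (hAB : ∫⁻ x, B x * B x = ∫⁻ x, A x * A x) (u) : cv A B u ≤ ∫⁻ x, A x * A x := by
  have h2 : ∀ a b : ENNReal, a * b ≤ 2⁻¹ * (a * a) + 2⁻¹ * (b * b) := by
    intro a b
    rcases eq_or_ne a ⊤ with rfl | ha
    · rcases eq_or_ne b 0 with rfl | hb
      · simp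
      · simp [ENNReal.mul_top]
    rcases eq_or_ne b ⊤ with rfl | hb
    · simp [ENNReal.mul_top]
    lift a to NNReal using ha
    lift b to NNReal using hb
    have : (2⁻¹ : ENNReal) = ((2⁻¹ : NNReal) : ENNReal) := by simp
    rw [this]
    norm_cast
    rw [← NNReal.coe_le_coe]
    push_cast
    nlinarith [sq_nonneg ((a:ℝ) - b)]
  calc cv A B u ≤ ∫⁻ y, (2⁻¹ * (A (u - y) * A (u - y)) + 2⁻¹ * (B y * B y)) :=
        lintegral_mono fun y => h2 _ _
    _ = 2⁻¹ * (∫⁻ x, A x * A x) + 2⁻¹ * (∫⁻ x, A x * A x) := by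
        rw [lintegral_add_left (by fun_prop), lintegral_const_mul _ (by fun_prop),
          lintegral_const_mul _ (by fun_prop), hAB,
          lintegral_sub_left_eq_self (μ := volume) (fun x => A x * A x) u]
    _ = _ := by rw [← add_mul, ENNReal.inv_two_add_inv_two, one_mul]

lemma wd_pos {n : ℕ} {A : (Fin n → ℝ) → ENNReal} (hA : Measurable A) :
    ∀ᵐ x ∂(volume.withDensity A), A x ≠ 0 := by
  rw [ae_withDensity_iff hA]
  exact Filter.Eventually.of_forall fun x h => h

lemma wd_int {n : ℕ} {A : (Fin n → ℝ) → ENNReal} (hA : Measurable A) (hfin : ∀ x, A x < ⊤)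
    (h : Integrable fun x => (A x).toReal * Real.log (A x).toReal) :
    Integrable (fun x => Real.log (A x).toReal) (volume.withDensity A) ∧
    ∫ x, Real.log (A x).toReal ∂(volume.withDensity A) =
      ∫ x, (A x).toReal * Real.log (A x).toReal := by
  constructor
  · rw [integrable_withDensity_iff_integrable_smul' hA (Filter.Eventually.of_forall hfin)]
    exact h
  · rw [integral_withDensity_eq_integral_toReal_smul hA (Filter.Eventually.of_forall hfin)]
    rfl

lemma mp_int {α β : Type*} [MeasurableSpace α] [MeasurableSpace β] {μ : Measure α} {ν : Measure β}
    {T : α → β} (hT : MeasurePreserving T μ ν) {g : β → ℝ} (hg : Measurable g) (hi : Integrable g ν) :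
    Integrable (fun x => g (T x)) μ ∧ ∫ x, g (T x) ∂μ = ∫ y, g y ∂ν := by
  constructor
  · exact hT.integrable_comp_of_integrable hi
  · rw [← hT.map_eq, integral_map hT.measurable.aemeasurable hg.aestronglyMeasurable]

lemma submod {n : ℕ} {P : (Fin n → ℝ) → ENNReal} (hP : Measurable P) (hP1 : ∫⁻ x, P x = 1)
    (hfin : ∀ x, P x < ⊤) (hsq : ∫⁻ x, P x * P x < ⊤)
    (F S : (Fin n → ℝ) → ENNReal) (hF : F = cv P (fun x => P (-x))) (hS : S = cv P P)
    (h1 : Integrable fun x => (P x).toReal * Real.log (P x).toReal)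
    (h2 : Integrable fun x => (F x).toReal * Real.log (F x).toReal)
    (h3 : Integrable fun x => (S x).toReal * Real.log (S x).toReal) :
    2 * (∫ x, (F x).toReal * Real.log (F x).toReal) ≤
      (∫ x, (S x).toReal * Real.log (S x).toReal) + ∫ x, (P x).toReal * Real.log (P x).toReal := by
  have hP' : Measurable fun x => P (-x) := by fun_prop
  have hP'1 : ∫⁻ x, P (-x) = 1 := by rw [lintegral_neg_eq_self]; exact hP1
  have hFm : Measurable F := hF ▸ cv_meas hP hP'
  have hSm : Measurable S := hS ▸ cv_meas hP hP
  have hF1 : ∫⁻ x, F x = 1 := hF ▸ cv_total hP hP' hP1 hP'1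
  have hS1 : ∫⁻ x, S x = 1 := hS ▸ cv_total hP hP hP1 hP1
  have hFle : ∀ x, F x ≤ ∫⁻ x, P x * P x := by
    intro x; rw [hF]
    exact cv_bound hP hP' (lintegral_neg_eq_self (μ := volume) (fun x => P x * P x)) x
  have hSle : ∀ x, S x ≤ ∫⁻ x, P x * P x := by
    intro x; rw [hS]; exact cv_bound hP hP rfl x
  have hFfin : ∀ x, F x < ⊤ := fun x => (hFle x).trans_lt hsq
  have hSfin : ∀ x, S x < ⊤ := fun x => (hSle x).trans_lt hsq
  set Q := cv F P with hQ
  have hQm : Measurable Q := cv_meas hFm hP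
  have hQ1 : ∫⁻ x, Q x = 1 := cv_total hFm hP hF1 hP1
  have hQfin : ∀ x, Q x < ⊤ := by
    intro x
    refine lt_of_le_of_lt ?_ hsq
    calc Q x ≤ ∫⁻ y, (∫⁻ x, P x * P x) * P y :=
          lintegral_mono fun y => mul_le_mul_left (hFle _) _
      _ = _ := by rw [lintegral_const_mul _ hP, hP1, mul_one]
  set μ := volume.withDensity P with hμ
  have : IsProbabilityMeasure μ := ⟨by rw [hμ, withDensity_apply _ MeasurableSet.univ]; simpa using hP1⟩
  set M := (μ.prod μ).prod μ with hM
  -- coordinates ω = ((x, z), y)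
  have mz : MeasurePreserving (fun ω : ((Fin n → ℝ) × (Fin n → ℝ)) × (Fin n → ℝ) => ω.1.2) M μ :=
    measurePreserving_snd.comp measurePreserving_fst
  have mxz2 : MeasurePreserving (fun ω : ((Fin n → ℝ) × (Fin n → ℝ)) => ω.1 - ω.2) (μ.prod μ)
      (volume.withDensity F) := by
    have := (cv_mp hP hP').comp ((MeasurePreserving.id μ).prod (neg_mp hP))
    rw [← hF] at this
    convert this using 1
    ext ω i
    simp [sub_eq_add_neg]
  have mxz : MeasurePreserving (fun ω : ((Fin n → ℝ) × (Fin n → ℝ)) × (Fin n → ℝ) => ω.1.1 - ω.1.2) M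
      (volume.withDensity F) := mxz2.comp measurePreserving_fst
  have myz : MeasurePreserving (fun ω : ((Fin n → ℝ) × (Fin n → ℝ)) × (Fin n → ℝ) => ω.2 - ω.1.2) M
      (volume.withDensity F) := by
    have a : MeasurePreserving (fun ω : ((Fin n → ℝ) × (Fin n → ℝ)) × (Fin n → ℝ) => (ω.1.2, ω.2)) M
      (μ.prod μ) := measurePreserving_snd.prod (MeasurePreserving.id μ)
    exact mxz2.comp (Measure.measurePreserving_swap.comp a)
  have mxy : MeasurePreserving (fun ω : ((Fin n → ℝ) × (Fin n → ℝ)) × (Fin n → ℝ) => ω.1.1 + ω.2) M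
      (volume.withDensity S) := by
    have a : MeasurePreserving (fun ω : ((Fin n → ℝ) × (Fin n → ℝ)) × (Fin n → ℝ) => (ω.1.1, ω.2)) M
      (μ.prod μ) := measurePreserving_fst.prod (MeasurePreserving.id μ)
    have := (cv_mp hP hP).comp a
    rw [← hS] at this
    exact this
  have mW : MeasurePreserving (fun ω : ((Fin n → ℝ) × (Fin n → ℝ)) × (Fin n → ℝ) => (ω.1.1 - ω.1.2) + ω.2) M
      (volume.withDensity Q) :=
    (cv_mp hFm hP).comp (mxz2.prod (MeasurePreserving.id μ))
  have lint3 : ∀ Φ : ((Fin n → ℝ) × (Fin n → ℝ)) × (Fin n → ℝ) → ENNReal, Measurable Φ →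
      ∫⁻ ω, Φ ω ∂M = ∫⁻ x, ∫⁻ z, P x * (P z * ∫⁻ y, P y * Φ ((x, z), y)) := by
    intro Φ hΦ
    rw [hM, lintegral_prod _ hΦ.aemeasurable, lint2 hP hP (by fun_prop)]
    refine lintegral_congr fun x => lintegral_congr fun z => ?_
    rw [lintegral_withDensity_eq_lintegral_mul _ hP (by fun_prop)]
    rfl
  set r1 : ((Fin n → ℝ) × (Fin n → ℝ)) × (Fin n → ℝ) → ENNReal := fun ω =>
    Q ((ω.1.1 - ω.1.2) + ω.2) / S (ω.1.1 + ω.2) with hr1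
  set r2 : ((Fin n → ℝ) × (Fin n → ℝ)) × (Fin n → ℝ) → ENNReal := fun ω =>
    (F (ω.1.1 - ω.1.2) * F (ω.2 - ω.1.2)) / (Q ((ω.1.1 - ω.1.2) + ω.2) * P ω.1.2) with hr2
  have hr1m : Measurable r1 := by fun_prop
  have hr2m : Measurable r2 := by fun_prop
  have E1 : ∫⁻ ω, r1 ω ∂M ≤ 1 := by
    rw [lint3 r1 hr1m]
    calc ∫⁻ x, ∫⁻ z, P x * (P z * ∫⁻ y, P y * r1 ((x, z), y))
        = ∫⁻ z, P z * ∫⁻ x, ∫⁻ y, P x * (P y * (Q ((x + y) - z) / S (x + y))) := by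
          rw [lintegral_lintegral_swap (by fun_prop)]
          refine lintegral_congr fun z => ?_
          rw [← lintegral_const_mul _ (by fun_prop)]
          refine lintegral_congr fun x => ?_
          rw [lintegral_const_mul _ (by fun_prop)]
          have e : ∀ y, r1 ((x, z), y) = Q ((x + y) - z) / S (x + y) := by
            intro y; simp only [hr1]; congr 2; abel
          simp only [e]
          ring
      _ = ∫⁻ z, P z * ∫⁻ u, S u * (Q (u - z) / S u) := by
          refine lintegral_congr fun z => ?_
          rw [cv_lint hP hP (φ := fun u => Q (u - z) / S u) (by fun_prop), ← hS]
      _ ≤ ∫⁻ z, P z * ∫⁻ u, Q (u - z) := by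
          gcongr with z u
          exact ENNReal.mul_div_le
      _ = 1 := by
          have e : ∀ z, ∫⁻ u, Q (u - z) = 1 := fun z =>
            (lintegral_sub_right_eq_self (μ := volume) Q z).trans hQ1
          simp only [e, mul_one, hP1]
  have E2 : ∫⁻ ω, r2 ω ∂M ≤ 1 := by
    rw [lint3 r2 hr2m]
    calc ∫⁻ x, ∫⁻ z, P x * (P z * ∫⁻ y, P y * r2 ((x, z), y))
        ≤ ∫⁻ x, ∫⁻ z, ∫⁻ y, (P x * P y) * ((F (x - z) * F (y - z)) / Q ((x - z) + y)) := by
          gcongr with x z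
          rw [← lintegral_const_mul _ (by fun_prop), ← lintegral_const_mul _ (by fun_prop)]
          refine lintegral_mono fun y => ?_
          simp only [hr2]
          rw [ENNReal.div_eq_inv_mul, ENNReal.mul_inv (Or.inr (hfin z).ne) (Or.inl (hQfin _).ne)]
          calc P x * (P z * (P y * ((Q (x - z + y))⁻¹ * (P z)⁻¹ * (F (x - z) * F (y - z)))))
              = (P x * P y) * ((F (x - z) * F (y - z)) * (Q (x - z + y))⁻¹) * (P z * (P z)⁻¹) := by ring
            _ ≤ (P x * P y) * ((F (x - z) * F (y - z)) * (Q (x - z + y))⁻¹) * 1 := by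
              gcongr; exact ENNReal.mul_inv_le_one _
            _ = _ := by rw [mul_one, div_eq_mul_inv]
      _ = ∫⁻ x, ∫⁻ y, ∫⁻ w, (P x * P y) * ((F (w - y) * F (w - x)) / Q w) := by
          refine lintegral_congr fun x => ?_
          rw [lintegral_lintegral_swap (by fun_prop)]
          refine lintegral_congr fun y => ?_
          rw [← lintegral_sub_left_eq_self (μ := volume) (fun w => (P x * P y) * ((F (w - y) * F (w - x)) / Q w)) (x + y)]
          refine lintegral_congr fun z => ?_
          rw [show x + y - z - y = x - z by abel, show x + y - z - x = y - z by abel,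
            show x + y - z = x - z + y by abel]
      _ = ∫⁻ x, ∫⁻ w, ∫⁻ y, (P x * P y) * ((F (w - y) * F (w - x)) / Q w) := by
          refine lintegral_congr fun x => ?_
          rw [lintegral_lintegral_swap (by fun_prop)]
      _ = ∫⁻ x, ∫⁻ w, (F (w - x) * P x) * (Q w * (Q w)⁻¹) := by
          refine lintegral_congr fun x => lintegral_congr fun w => ?_
          have : ∀ y, (P x * P y) * ((F (w - y) * F (w - x)) / Q w) =
            (F (w - y) * P y) * ((F (w - x) * P x) * (Q w)⁻¹) := by
            intro y; rw [div_eq_mul_inv]; ring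
          simp only [this]
          rw [lintegral_mul_const _ (by fun_prop)]
          change Q w * _ = _
          ring
      _ ≤ ∫⁻ x, ∫⁻ w, (F (w - x) * P x) * 1 := by
          gcongr; exact ENNReal.mul_inv_le_one _
      _ = ∫⁻ w, Q w := by
          simp only [mul_one]
          rw [lintegral_lintegral_swap (by fun_prop)]
          rfl
      _ = 1 := hQ1
  obtain ⟨iP, eP⟩ := wd_int hP hfin h1
  obtain ⟨iF, eF⟩ := wd_int hFm hFfin h2
  obtain ⟨iS, eS⟩ := wd_int hSm hSfin h3
  have lm : ∀ {A : (Fin n → ℝ) → ENNReal}, Measurable A → Measurable fun x => Real.log (A x).toReal :=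
    fun h => Real.measurable_log.comp h.ennreal_toReal
  obtain ⟨jP, dP⟩ := mp_int mz (lm hP) iP
  obtain ⟨jF1, dF1⟩ := mp_int mxz (lm hFm) iF
  obtain ⟨jF2, dF2⟩ := mp_int myz (lm hFm) iF
  obtain ⟨jS, dS⟩ := mp_int mxy (lm hSm) iS
  have k1 : Integrable (fun ω => (r1 ω).toReal) M :=
    integrable_toReal_of_lintegral_ne_top hr1m.aemeasurable (E1.trans_lt (by simp)).ne
  have k2 : Integrable (fun ω => (r2 ω).toReal) M :=
    integrable_toReal_of_lintegral_ne_top hr2m.aemeasurable (E2.trans_lt (by simp)).ne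
  have K1 : ∫ ω, (r1 ω).toReal ∂M ≤ 1 := by
    rw [integral_toReal hr1m.aemeasurable (ae_lt_top hr1m (E1.trans_lt (by simp)).ne)]
    exact ENNReal.toReal_le_of_le_ofReal zero_le_one (by simpa using E1)
  have K2 : ∫ ω, (r2 ω).toReal ∂M ≤ 1 := by
    rw [integral_toReal hr2m.aemeasurable (ae_lt_top hr2m (E2.trans_lt (by simp)).ne)]
    exact ENNReal.toReal_le_of_le_ofReal zero_le_one (by simpa using E2)
  have hae : (fun ω : ((Fin n → ℝ) × (Fin n → ℝ)) × (Fin n → ℝ) =>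
      (Real.log (F (ω.1.1 - ω.1.2)).toReal + Real.log (F (ω.2 - ω.1.2)).toReal)
        - (Real.log (S (ω.1.1 + ω.2)).toReal + Real.log (P ω.1.2).toReal)) ≤ᵐ[M]
      fun ω => ((r1 ω).toReal + (r2 ω).toReal) - 2 := by
    filter_upwards [mz.quasiMeasurePreserving.ae (wd_pos hP), mxz.quasiMeasurePreserving.ae (wd_pos hFm),
      myz.quasiMeasurePreserving.ae (wd_pos hFm), mxy.quasiMeasurePreserving.ae (wd_pos hSm),
      mW.quasiMeasurePreserving.ae (wd_pos hQm)] with ω a1 a2 a3 a4 a5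
    have b1 := ENNReal.toReal_pos a1 (hfin _).ne
    have b2 := ENNReal.toReal_pos a2 (hFfin _).ne
    have b3 := ENNReal.toReal_pos a3 (hFfin _).ne
    have b4 := ENNReal.toReal_pos a4 (hSfin _).ne
    have b5 := ENNReal.toReal_pos a5 (hQfin _).ne
    simp only [hr1, hr2, ENNReal.toReal_div, ENNReal.toReal_mul]
    have c1 := Real.log_le_sub_one_of_pos (div_pos b5 b4)
    have c2 := Real.log_le_sub_one_of_pos (div_pos (mul_pos b2 b3) (mul_pos b5 b1))
    rw [Real.log_div b5.ne' b4.ne'] at c1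
    rw [Real.log_div (mul_pos b2 b3).ne' (mul_pos b5 b1).ne', Real.log_mul b2.ne' b3.ne',
      Real.log_mul b5.ne' b1.ne'] at c2
    linarith
  have j12 : Integrable (fun ω : ((Fin n → ℝ) × (Fin n → ℝ)) × (Fin n → ℝ) =>
      Real.log (F (ω.1.1 - ω.1.2)).toReal + Real.log (F (ω.2 - ω.1.2)).toReal) M := jF1.add jF2
  have j34 : Integrable (fun ω : ((Fin n → ℝ) × (Fin n → ℝ)) × (Fin n → ℝ) =>
      Real.log (S (ω.1.1 + ω.2)).toReal + Real.log (P ω.1.2).toReal) M := jS.add jP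
  have k12 : Integrable (fun ω => (r1 ω).toReal + (r2 ω).toReal) M := k1.add k2
  have hfinal := integral_mono_ae (j12.sub j34) (k12.sub (integrable_const 2)) hae
  simp only [Pi.sub_apply] at hfinal
  rw [integral_sub j12 j34, integral_sub k12 (integrable_const 2),
    integral_add jF1 jF2, integral_add jS jP, integral_add k1 k2, dF1, dF2, dS, dP, eF, eS, eP] at hfinal
  simp only [integral_const, probReal_univ, smul_eq_mul] at hfinal
  linarith

lemma jensen {n : ℕ} (q : (Fin n → ℝ) → ℝ) (hq : ∀ x, 0 ≤ q x) (hqi : Integrable q) (hq1 : ∫ x, q x = 1)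
    (hqq : Integrable fun x => q x * q x) (c : ℝ) (hc : c = ∫ x, q x * q x) (hc0 : 0 < c)
    (h1 : Integrable fun x => q x * Real.log (q x)) :
    ∫ x, q x * Real.log (q x) ≤ Real.log c := by
  have hpt : ∀ x, q x * Real.log (q x) ≤ c⁻¹ * (q x * q x) + (Real.log c - 1) * q x := by
    intro x
    rcases eq_or_lt_of_le (hq x) with h | h
    · rw [← h]; simp
    · have := Real.log_le_sub_one_of_pos (div_pos h hc0)
      rw [Real.log_div h.ne' hc0.ne'] at this
      have h2 := mul_le_mul_of_nonneg_left this h.le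
      have : q x * (q x / c - 1) = c⁻¹ * (q x * q x) - q x := by field_simp
      linarith
  have := integral_mono h1 ((hqq.const_mul c⁻¹).add (hqi.const_mul (Real.log c - 1))) hpt
  refine this.trans (le_of_eq ?_)
  simp only [Pi.add_apply]
  rw [integral_add (hqq.const_mul c⁻¹) (hqi.const_mul (Real.log c - 1)), integral_const_mul, integral_const_mul,
    ← hc, hq1]
  field_simp
  ring

theorem stmt_18 (n : ℕ) (hn : 0 < n) (β β₀ : ℝ) (hβ₀ : 1 < β₀)
    (hβ : max ((n : ℝ) + 1) (β₀ * n) ≤ β)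
    (p : (Fin n → ℝ) → ℝ)
    (hnn : ∀ x, 0 ≤ p x) (hpdf : ∫ x, p x = 1)
    (f s : (Fin n → ℝ) → ℝ)
    (hf : f = fun x => ∫ y, p (x + y) * p y)
    (hs : s = fun x => ∫ y, p (x - y) * p y)
    (V : (Fin n → ℝ) → ℝ)
    (hV : ConvexOn ℝ {x | 0 < f x} V)
    (hform : ∀ x, 0 < f x → 0 < V x ∧ f x = V x ^ (-β))
    (h1 : Integrable fun x => p x * Real.log (p x))
    (h2 : Integrable fun x => f x * Real.log (f x))
    (h3 : Integrable fun x => s x * Real.log (s x)) :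
    Real.exp (2 * (-∫ x, f x * Real.log (f x)) / n) ≤
      Real.exp (2 * β₀ / (β₀ - 1)) * Real.exp (2 * (-∫ x, p x * Real.log (p x)) / n) ∧
    Real.exp (2 * (-∫ x, s x * Real.log (s x)) / n) ≤
      Real.exp (2 * β₀ / (β₀ - 1)) ^ 2 *
        Real.exp (2 * (-∫ x, p x * Real.log (p x)) / n) := by
  have hpi : Integrable p := by
    by_contra h
    rw [integral_undef h] at hpdf
    exact zero_ne_one hpdf
  obtain ⟨P, hP, hPfin, hPp⟩ : ∃ P : (Fin n → ℝ) → ENNReal, Measurable P ∧ (∀ x, P x < ⊤) ∧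
      p =ᵐ[volume] fun x => (P x).toReal := by
    refine ⟨fun x => ENNReal.ofReal (hpi.1.mk p x), hpi.1.stronglyMeasurable_mk.measurable.ennreal_ofReal,
      fun x => ENNReal.ofReal_lt_top, ?_⟩
    filter_upwards [hpi.1.ae_eq_mk] with x hx
    rw [← hx, ENNReal.toReal_ofReal (hnn x)]
  set q : (Fin n → ℝ) → ℝ := fun x => (P x).toReal with hq
  have hqnn : ∀ x, 0 ≤ q x := fun x => ENNReal.toReal_nonneg
  have hqm : Measurable q := hP.ennreal_toReal
  have hqi : Integrable q := hpi.congr hPp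
  have hq1 : ∫ x, q x = 1 := by rw [← hpdf]; exact integral_congr_ae hPp.symm
  have hP1 : ∫⁻ x, P x = 1 := by
    have h := ofReal_integral_eq_lintegral_ofReal hqi (Filter.Eventually.of_forall hqnn)
    rw [hq1] at h
    simp only [hq, ENNReal.ofReal_toReal (hPfin _).ne] at h
    simpa using h.symm
  have hP' : Measurable fun x => P (-x) := by fun_prop
  have hP'1 : ∫⁻ x, P (-x) = 1 := by rw [lintegral_neg_eq_self]; exact hP1
  set F := cv P (fun x => P (-x)) with hF
  set S := cv P P with hS
  have hFm : Measurable F := cv_meas hP hP'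
  have hF1 : ∫⁻ x, F x = 1 := cv_total hP hP' hP1 hP'1
  have hfF : ∀ x, f x = (F x).toReal := by
    intro x
    have e : f x = ∫ y, q (x + y) * q y := by
      rw [hf]
      apply integral_congr_ae
      have := (measurePreserving_add_left volume x).quasiMeasurePreserving.ae_eq_comp hPp
      filter_upwards [this, hPp] with y h1 h2
      simp only [Function.comp] at h1
      rw [h1, h2]
    rw [e, integral_eq_lintegral_of_nonneg_ae
      (Filter.Eventually.of_forall fun y => mul_nonneg (hqnn _) (hqnn _))
      (by exact (Measurable.aestronglyMeasurable (by fun_prop)))]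
    congr 1
    rw [hF]; unfold cv
    rw [← lintegral_neg_eq_self]
    refine lintegral_congr fun y => ?_
    rw [ENNReal.ofReal_mul (hqnn _)]
    simp only [hq, ENNReal.ofReal_toReal (hPfin _).ne, sub_neg_eq_add, neg_neg, sub_eq_add_neg]
  have hsS : ∀ x, s x = (S x).toReal := by
    intro x
    have e : s x = ∫ y, q (x - y) * q y := by
      rw [hs]
      apply integral_congr_ae
      have := (Measure.measurePreserving_sub_left volume x).quasiMeasurePreserving.ae_eq_comp hPp
      filter_upwards [this, hPp] with y h1 h2
      simp only [Function.comp] at h1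
      rw [h1, h2]
    rw [e, integral_eq_lintegral_of_nonneg_ae
      (Filter.Eventually.of_forall fun y => mul_nonneg (hqnn _) (hqnn _))
      (by exact (Measurable.aestronglyMeasurable (by fun_prop)))]
    congr 1
    rw [hS]; unfold cv
    refine lintegral_congr fun y => ?_
    rw [ENNReal.ofReal_mul (hqnn _)]
    simp only [hq, ENNReal.ofReal_toReal (hPfin _).ne]
  have hsymm : ∀ x, f (-x) = f x := by
    intro x
    rw [hf]
    change ∫ y, p (-x + y) * p y = ∫ y, p (x + y) * p y
    rw [← integral_add_left_eq_self (fun y => p (-x + y) * p y) x]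
    refine integral_congr_ae (Filter.Eventually.of_forall fun y => ?_)
    simp [mul_comm]
  have hfnn : ∀ x, 0 ≤ f x := fun x => by rw [hfF]; exact ENNReal.toReal_nonneg
  have hFae : ∀ᵐ x, F x < ⊤ := ae_lt_top hFm (by rw [hF1]; simp)
  have hex : ∃ x, 0 < f x := by
    by_contra! h
    have : F =ᵐ[volume] 0 := by
      filter_upwards [hFae] with x hx
      have h0 : (F x).toReal = 0 := by rw [← hfF]; exact le_antisymm (h x) (hfnn x)
      rcases (ENNReal.toReal_eq_zero_iff _).1 h0 with h' | h'
      · exact h'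
      · exact absurd h' hx.ne
    rw [lintegral_congr_ae this] at hF1
    simp at hF1
  have hf0 : 0 < f 0 := by
    obtain ⟨x, hx⟩ := hex
    have hx' : 0 < f (-x) := by rw [hsymm]; exact hx
    have := hV.1 (show x ∈ {x | 0 < f x} from hx) (show -x ∈ {x | 0 < f x} from hx')
      (show (0:ℝ) ≤ 1/2 by norm_num) (show (0:ℝ) ≤ 1/2 by norm_num) (by norm_num)
    simpa using this
  have hF0 : F 0 = ∫⁻ x, P x * P x := by
    rw [hF]; unfold cv
    simp only [zero_sub]
    exact lintegral_neg_eq_self (μ := volume) (fun x => P x * P x)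
  have hsq : ∫⁻ x, P x * P x < ⊤ := by
    rw [← hF0]
    rw [hfF] at hf0
    exact lt_top_iff_ne_top.2 (fun h => by rw [h] at hf0; simp at hf0)
  have hmax : ∀ x, f x ≤ f 0 := by
    intro x
    rw [hfF, hfF]
    refine ENNReal.toReal_mono (hF0 ▸ hsq.ne) ?_
    rw [hF0]
    exact cv_bound hP hP' (lintegral_neg_eq_self (μ := volume) (fun x => P x * P x)) x
  have hfe : f = fun x => (F x).toReal := funext hfF
  have hse : s = fun x => (S x).toReal := funext hsS
  have hfm : Measurable f := hfe ▸ hFm.ennreal_toReal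
  have hfi : Integrable f := by
    rw [hfe]; exact integrable_toReal_of_lintegral_ne_top hFm.aemeasurable (by rw [hF1]; simp)
  have hf1 : ∫ x, f x = 1 := by
    rw [hfe, integral_toReal hFm.aemeasurable hFae, hF1]; simp
  have hplog : (fun x => p x * Real.log (p x)) =ᵐ[volume] fun x => q x * Real.log (q x) := by
    filter_upwards [hPp] with x hx
    rw [hx]
  have h1q : Integrable fun x => q x * Real.log (q x) := h1.congr hplog
  have hpq : ∫ x, p x * Real.log (p x) = ∫ x, q x * Real.log (q x) := integral_congr_ae hplog
  have hqq : Integrable fun x => q x * q x := by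
    have : (fun x => q x * q x) = fun x => (P x * P x).toReal := by
      funext x; rw [ENNReal.toReal_mul]
    rw [this]
    exact integrable_toReal_of_lintegral_ne_top (by fun_prop) hsq.ne
  have hc : f 0 = ∫ x, q x * q x := by
    have : (fun x => q x * q x) = fun x => (P x * P x).toReal := by
      funext x; rw [ENNReal.toReal_mul]
    rw [this, integral_toReal (by fun_prop)
      (Filter.Eventually.of_forall fun x => ENNReal.mul_lt_top (hPfin x) (hPfin x)), hfF, hF0]
  have hJ := jensen q hqnn hqi hq1 hqq (f 0) hc hf0 h1q
  have hsub : 2 * (∫ x, f x * Real.log (f x)) ≤ (∫ x, s x * Real.log (s x)) + ∫ x, q x * Real.log (q x) := by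
    have := submod hP hP1 hPfin hsq F S hF hS h1q (by rw [hfe] at h2; exact h2) (by rw [hse] at h3; exact h3)
    rw [hfe, hse]; exact this
  have hb1 : (n : ℝ) + 1 ≤ β := (le_max_left _ _).trans hβ
  have hb2 : β₀ * n ≤ β := (le_max_right _ _).trans hβ
  have hn' : (0 : ℝ) < n := by exact_mod_cast hn
  have hkey : -∫ x, f x * Real.log (f x) ≤ -Real.log (f 0) + n * β / (β - n) := by
    obtain ⟨m, rfl⟩ : ∃ m, n = m + 1 := ⟨n - 1, by omega⟩
    push_cast at hb1
    have := key m (β := β) (by linarith) f V hfm hfnn hfi hf1 hf0 hmax hV hform h2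
    push_cast
    exact this
  have hB : n * β / (β - n) ≤ n * (β₀ / (β₀ - 1)) := by
    rw [mul_div_assoc]
    refine mul_le_mul_of_nonneg_left ?_ hn'.le
    rw [div_le_div_iff₀ (by linarith) (by linarith)]
    nlinarith
  rw [hpq]
  set hp := ∫ x, q x * Real.log (q x)
  set hfv := ∫ x, f x * Real.log (f x)
  set hsv := ∫ x, s x * Real.log (s x)
  set D := β₀ / (β₀ - 1) with hD
  have hDe : 2 * β₀ / (β₀ - 1) = 2 * D := by rw [hD]; ring
  have g1 : -hfv ≤ -hp + n * D := by linarith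
  have g2 : -hsv ≤ -hp + 2 * (n * D) := by linarith
  rw [hDe, ← Real.exp_nat_mul, ← Real.exp_add, ← Real.exp_add, Real.exp_le_exp, Real.exp_le_exp]
  constructor
  · rw [div_le_iff₀ hn', add_mul, div_mul_cancel₀ _ hn'.ne']; linarith
  · rw [div_le_iff₀ hn', add_mul, div_mul_cancel₀ _ hn'.ne']; push_cast; linarith
end
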